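/- arXiv:2206.08116 — 5 statements merged into one kernel-verified Lean document; each statement's English description precedes it below -/
import Mathlib

section
/- Let n ≥ 2 be an integer and assume f_n := X^n − X − 1 is irreducible over ℚ (Selmer), so that K_{f_n} := ℚ[X]/(f_n) is a number field of degree n. Then the discriminant of the number field K_{f_n} is a squarefree integer. -/
open Polynomial

/-- If an ideal `F` with `F * D = (δ)` is contained in `ℤ + (δ)`, then every element of the ring
is congruent to an integer modulo `D`. -/
theorem Ideal.exists_int_sub_mem_of_mul_eq_span_singleton {B : Type*} [CommRing B]
    [IsDedekindDomain B] {F D : Ideal B} {δ : B} (hδ : δ ≠ 0) (hFD : F * D = Ideal.span {δ})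
    (hF : ∀ x ∈ F, ∃ k : ℤ, x - k ∈ Ideal.span {δ}) (y : B) : ∃ k : ℤ, y - k ∈ D := by
  have hF0 : F ≠ ⊥ := by
    rintro rfl
    rw [Ideal.bot_mul] at hFD
    exact hδ (Ideal.span_singleton_eq_bot.mp hFD.symm)
  have hδF : Ideal.span {δ} ≤ F := hFD ▸ Ideal.mul_le_left
  have hint : ∀ x ∈ F, ∀ k : ℤ, x - k ∈ Ideal.span {δ} → (k : B) ∈ F := fun x hx k hk ↦ by
    simpa using F.sub_mem hx (hδF hk)
  obtain ⟨m, hm⟩ := (IsPrincipalIdealRing.principal (F.comap (Int.castRingHom B))).principal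
  have hmF : ∀ k : ℤ, (k : B) ∈ F ↔ m ∣ k := fun k ↦ by
    rw [← Ideal.mem_span_singleton, Ideal.span, ← hm]
    simp [Ideal.mem_comap]
  have hmm : (m : B) ∈ F := (hmF m).mpr dvd_rfl
  obtain ⟨k, hk⟩ := hF _ (F.mul_mem_right y hmm)
  obtain ⟨j, rfl⟩ := (hmF k).mp (hint _ (F.mul_mem_right y hmm) k hk)
  have hmj : (m : B) * (y - j) ∈ Ideal.span {δ} := by
    have : (m : B) * (y - j) = m * y - (m * j : ℤ) := by push_cast; ring
    rwa [this]
  refine ⟨j, ?_⟩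
  have hle : F * Ideal.span {y - (j : B)} ≤ F * D := by
    rw [hFD, Ideal.mul_le]
    intro u hu s hs
    obtain ⟨t, rfl⟩ := Ideal.mem_span_singleton'.mp hs
    obtain ⟨k', hk'⟩ := hF u hu
    obtain ⟨i, rfl⟩ := (hmF k').mp (hint u hu k' hk')
    have : u * (t * (y - j)) =
        t * (y - j) * (u - (m * i : ℤ)) + t * i * ((m : B) * (y - j)) := by push_cast; ring
    rw [this]
    exact Ideal.add_mem _ (Ideal.mul_mem_left _ _ hk') (Ideal.mul_mem_left _ _ hmj)
  rw [← Ideal.dvd_iff_le, mul_dvd_mul_iff_left hF0, Ideal.dvd_iff_le] at hle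
  exact hle (Ideal.mem_span_singleton_self _)

/-- If every element of the ring is an integer modulo the ideal `D`, then every integer in `D` is
divisible by the norm of `D`. -/
theorem Ideal.absNorm_dvd_of_forall_exists_int_sub_mem {B : Type*} [CommRing B]
    [IsDedekindDomain B] [Module.Free ℤ B] {D : Ideal B}
    (h : ∀ y : B, ∃ k : ℤ, y - k ∈ D) {k : ℤ} (hk : (k : B) ∈ D) :
    (Ideal.absNorm D : ℤ) ∣ k := by
  have hz : ∀ z : B ⧸ D, z ∈ AddSubgroup.zmultiples (1 : B ⧸ D) := by
    intro z
    obtain ⟨y, rfl⟩ := Ideal.Quotient.mk_surjective z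
    obtain ⟨j, hj⟩ := h y
    refine AddSubgroup.mem_zmultiples_iff.mpr ⟨j, ?_⟩
    rw [← Ideal.Quotient.mk_eq_mk_iff_sub_mem] at hj
    simp [hj]
  rw [Ideal.absNorm_apply, Submodule.cardQuot_apply,
    ← addOrderOf_eq_card_of_forall_mem_zmultiples hz, addOrderOf_dvd_iff_zsmul_eq_zero]
  rw [zsmul_one, ← map_intCast (Ideal.Quotient.mk D)]
  exact Ideal.Quotient.eq_zero_iff_mem.mpr hk

/-- If every element of the ring is an integer modulo the ideal `D` and `p ^ 2` divides the norm
of `D`, then some prime above `p` is unramified and divides `D`. -/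
theorem Ideal.exists_isCoprime_mul_eq_span_natCast_of_sq_dvd_absNorm {B : Type*} [CommRing B]
    [IsDedekindDomain B] [Module.Free ℤ B] {D : Ideal B}
    (h : ∀ y : B, ∃ k : ℤ, y - k ∈ D) {p : ℕ} (hp : p.Prime) (hpD : p * p ∣ Ideal.absNorm D) :
    ∃ P Q : Ideal B, P.IsMaximal ∧ IsCoprime P Q ∧ P * Q = Ideal.span {(p : B)} ∧ P ∣ D := by
  have hdvd : ∀ k : ℤ, (k : B) ∈ D → (p * p : ℤ) ∣ k := fun k hk ↦
    dvd_trans (by exact_mod_cast hpD) (Ideal.absNorm_dvd_of_forall_exists_int_sub_mem h hk)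
  have hp' : _root_.Prime (p : ℤ) := Nat.prime_iff_prime_int.mp hp
  have hp1 : ¬ (p : ℤ) ∣ 1 := fun H ↦ hp'.not_isUnit (isUnit_of_dvd_one H)
  set P : Ideal (B) := Ideal.span {(p : B)} ⊔ D with hP
  have hpP : (p : B) ∈ P := Ideal.mem_sup_left (Ideal.mem_span_singleton_self _)
  have hmax : P.IsMaximal := by
    rw [Ideal.isMaximal_iff]
    constructor
    · intro h1
      obtain ⟨a, ha, d, hd, hadd⟩ := Submodule.mem_sup.mp h1
      obtain ⟨x, rfl⟩ := Ideal.mem_span_singleton'.mp ha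
      obtain ⟨t, ht⟩ := h x
      have hmem : ((1 - t * p : ℤ) : B) ∈ D := by
        have : ((1 - t * p : ℤ) : B) = p * (x - t) + d := by
          push_cast
          linear_combination -hadd
        rw [this]
        exact D.add_mem (D.mul_mem_left _ ht) hd
      refine hp1 ?_
      have := (dvd_mul_right (p : ℤ) p).trans (hdvd _ hmem)
      simpa using dvd_add this (dvd_mul_left (p : ℤ) t)
    · intro J x hPJ hxP hxJ
      obtain ⟨k, hk⟩ := h x
      have hkJ : (k : B) ∈ J := by
        simpa using J.sub_mem hxJ (hPJ (Ideal.mem_sup_right hk))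
      have hpk : ¬ (p : ℤ) ∣ k := by
        rintro ⟨c, rfl⟩
        apply hxP
        have : x = (x - ((p * c : ℤ) : B)) + c * p := by push_cast; ring
        rw [this]
        exact P.add_mem (Ideal.mem_sup_right hk) (P.mul_mem_left _ hpP)
      obtain ⟨a, b, hab⟩ := (hp'.irreducible.coprime_iff_not_dvd.mpr hpk)
      have hab' : (a : B) * p + b * k = 1 := by exact_mod_cast congrArg (Int.cast : ℤ → B) hab
      rw [← hab']
      exact J.add_mem (J.mul_mem_left _ (hPJ hpP)) (J.mul_mem_left _ hkJ)
  have hP2 : P * P ≤ Ideal.span {((p : B) * p)} ⊔ D := by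
    rw [hP, Ideal.mul_sup, Ideal.sup_mul, Ideal.span_singleton_mul_span_singleton]
    exact sup_le (sup_le le_sup_left (Ideal.mul_le_left.trans le_sup_right))
      (Ideal.mul_le_right.trans le_sup_right)
  have hpP2 : (p : B) ∉ P * P := by
    intro hmem
    obtain ⟨a, ha, d, hd, hadd⟩ := Submodule.mem_sup.mp (hP2 hmem)
    obtain ⟨x, rfl⟩ := Ideal.mem_span_singleton'.mp ha
    obtain ⟨t, ht⟩ := h x
    have hmem : ((p - t * (p * p) : ℤ) : B) ∈ D := by
      have : ((p - t * (p * p) : ℤ) : B) = (p * p) * (x - t) + d := by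
        push_cast
        linear_combination -hadd
      rw [this]
      exact D.add_mem (D.mul_mem_left _ ht) hd
    have := dvd_add (hdvd _ hmem) (dvd_mul_left (p * p : ℤ) t)
    rw [sub_add_cancel] at this
    refine hp1 ((mul_dvd_mul_iff_left hp'.ne_zero).mp ?_)
    rwa [mul_one]
  obtain ⟨Q, hQ⟩ : P ∣ Ideal.span {(p : B)} := Ideal.dvd_iff_le.mpr le_sup_left
  have hPQ : IsCoprime P Q := by
    rw [Ideal.isCoprime_iff_sup_eq]
    by_contra hne
    have hQP : Q ≤ P := le_sup_right.trans (hmax.eq_of_le hne le_sup_left).ge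
    exact hpP2 (Ideal.mul_mono_right hQP (hQ ▸ Ideal.mem_span_singleton_self _))
  exact ⟨P, Q, hmax, hPQ, hQ.symm, Ideal.dvd_iff_le.mpr le_sup_right⟩

open scoped NumberField in
/-- A number field has squarefree discriminant if `ℤ` surjects onto the quotient of the ring of
integers by the different. -/
theorem NumberField.squarefree_discr_of_forall_exists_int_sub_mem (K : Type*) [Field K]
    [NumberField K] (h : ∀ y : 𝓞 K, ∃ k : ℤ, y - k ∈ differentIdeal ℤ (𝓞 K)) :
    Squarefree (discr K) := by
  rw [← Int.squarefree_natAbs, Nat.squarefree_iff_prime_squarefree]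
  intro p hp hpd
  rw [← absNorm_differentIdeal K (𝓞 K)] at hpd
  obtain ⟨P, Q, hmax, hPQ, hQ, hPD⟩ :=
    Ideal.exists_isCoprime_mul_eq_span_natCast_of_sq_dvd_absNorm h hp hpd
  have : (Ideal.span {(p : ℤ)}).IsMaximal :=
    PrincipalIdealRing.isMaximal_of_irreducible (Nat.prime_iff_prime_int.mp hp).irreducible
  have : Finite (ℤ ⧸ Ideal.span {(p : ℤ)}) :=
    Ideal.finiteQuotientOfFreeOfNeBot _ (by simpa using hp.ne_zero)
  exact not_dvd_differentIdeal_of_isCoprime (p := Ideal.span {(p : ℤ)}) ℤ P Q hPQ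
    (by rw [hQ, Ideal.map_span]; simp) hPD

/-- Modulo the derivative of `X ^ n - X - 1` at a root `x`, every polynomial expression in `x` is
congruent to an integer. -/
theorem exists_int_sub_mem_span_of_pow_eq_add_one {B : Type*} [CommRing B] {n : ℕ} (hn : 2 ≤ n)
    {x : B} (hx : x ^ n = x + 1) {y : B} (hy : y ∈ Algebra.adjoin ℤ {x}) :
    ∃ k : ℤ, y - k ∈ Ideal.span {n * x ^ (n - 1) - 1} := by
  obtain ⟨n, rfl⟩ : ∃ m, n = m + 1 := ⟨n - 1, by omega⟩
  set I : Ideal B := Ideal.span {((n + 1 : ℕ) : B) * x ^ (n + 1 - 1) - 1} with hI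
  set q := Ideal.Quotient.mk I
  have h0 : (n : B ⧸ I) * q x = - (n + 1) := by
    have : (n : B) * x + (n + 1) ∈ I := by
      refine Ideal.mem_span_singleton'.mpr ⟨x, ?_⟩
      simp only [Nat.add_sub_cancel]
      push_cast
      linear_combination (n + 1 : B) * hx
    have := Ideal.Quotient.eq_zero_iff_mem.mpr this
    simp only [map_add, map_mul, map_natCast, map_one] at this
    linear_combination this
  have hqx : q x ^ (n + 1) = q x + 1 := by rw [← map_pow, hx]; simp
  have hM : (((-(n + 1)) ^ (n + 1) + n ^ n : ℤ) : B ⧸ I) = 0 := by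
    have h1 : (n : B ⧸ I) ^ (n + 1) * q x ^ (n + 1) = (-(n + 1)) ^ (n + 1) := by
      rw [← mul_pow, h0]
    push_cast
    rw [← h1, hqx]
    linear_combination (n : B ⧸ I) ^ n * h0
  have hcop : IsCoprime (n : ℤ) ((-(n + 1)) ^ (n + 1) + n ^ n) := by
    have h1 : IsCoprime (n : ℤ) ((-(n + 1)) ^ (n + 1)) :=
      IsCoprime.pow_right ⟨-1, -1, by ring⟩
    obtain ⟨c, hc⟩ : (n : ℤ) ∣ n ^ n := dvd_pow_self _ (by omega)
    rw [hc]
    exact h1.add_mul_left_right c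
  obtain ⟨a, b, hab⟩ := hcop
  have hab' : (a : B ⧸ I) * n = 1 := by
    have := congrArg (Int.cast : ℤ → B ⧸ I) hab
    rw [Int.cast_add, Int.cast_mul b, hM] at this
    simpa using this
  have hxa : q x = ((-a - 1 : ℤ) : B ⧸ I) := by
    push_cast
    linear_combination (-q x - 1) * hab' + (a : B ⧸ I) * h0
  have key : q y ∈ (Algebra.ofId ℤ (B ⧸ I)).range := by
    have : Algebra.adjoin ℤ {x} ≤
        (Algebra.ofId ℤ (B ⧸ I)).range.comap (Ideal.Quotient.mkₐ ℤ I) := by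
      rw [Algebra.adjoin_le_iff, Set.singleton_subset_iff]
      exact ⟨-a - 1, hxa.symm⟩
    exact this hy
  obtain ⟨k, hk⟩ := key
  refine ⟨k, ?_⟩
  rw [← Ideal.Quotient.mk_eq_mk_iff_sub_mem, map_intCast]
  exact hk.symm

/-- Let `n ≥ 2` and assume `X^n - X - 1` is irreducible over `ℚ` (Selmer), so that
`K = ℚ[X]/(X^n - X - 1)` is a number field. Then the discriminant of the number field
`K` is squarefree. -/
theorem discr_numberField_squarefree (n : ℕ) (hn : 2 ≤ n)
    (hirr : Irreducible (X ^ n - X - 1 : ℚ[X]))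
    (K : Type) [Field K] [NumberField K]
    (e : K ≃ₐ[ℚ] AdjoinRoot (X ^ n - X - 1 : ℚ[X])) :
    Squarefree (NumberField.discr K) := by
  have hmon : (X ^ n - X - 1 : ℤ[X]).Monic := by
    rw [sub_sub]
    refine monic_X_pow_sub ?_
    rw [← C_1, degree_X_add_C]
    exact_mod_cast hn
  have hmap : (X ^ n - X - 1 : ℤ[X]).map (algebraMap ℤ ℚ) = X ^ n - X - 1 := by simp
  set f : ℚ[X] := X ^ n - X - 1 with hf
  set α : K := e.symm (AdjoinRoot.root f) with hα
  have hαf : aeval α f = 0 := by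
    rw [hα, ← AlgEquiv.coe_toAlgHom, aeval_algHom_apply, AdjoinRoot.aeval_eq, AdjoinRoot.mk_self,
      map_zero]
  have hroot : α ^ n = α + 1 := by
    simp only [hf, map_sub, map_pow, aeval_X, map_one] at hαf
    linear_combination hαf
  have hint : IsIntegral ℤ α := ⟨X ^ n - X - 1, hmon, by simp [hroot]⟩
  set θ : NumberField.RingOfIntegers K := ⟨α, hint⟩
  have hθα : algebraMap (NumberField.RingOfIntegers K) K θ = α := rfl
  have hθ : θ ^ n = θ + 1 := by
    apply FaithfulSMul.algebraMap_injective (NumberField.RingOfIntegers K) K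
    simp [hθα, hroot]
  have hmin : minpoly ℤ θ = X ^ n - X - 1 := by
    apply map_injective (algebraMap ℤ ℚ) (algebraMap ℤ ℚ).injective_int
    rw [hmap, ← minpoly.isIntegrallyClosed_eq_field_fractions ℚ K
      (NumberField.RingOfIntegers.isIntegral θ), hθα]
    exact (minpoly.eq_of_irreducible_of_monic hirr hαf (hmap ▸ hmon.map _)).symm
  have htop : Algebra.adjoin ℚ {algebraMap (NumberField.RingOfIntegers K) K θ} = ⊤ := by
    have := congrArg (Subalgebra.map (e.symm : _ →ₐ[ℚ] K)) (AdjoinRoot.adjoinRoot_eq_top (f := f))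
    rw [AlgHom.map_adjoin_singleton, Algebra.map_top] at this
    rw [hθα, hα]
    refine this.trans ?_
    exact (AlgHom.range_eq_top _).mpr e.symm.surjective
  have hder : aeval θ (derivative (minpoly ℤ θ)) = n * θ ^ (n - 1) - 1 := by
    rw [hmin]
    simp [derivative_X_pow]
  have hcond := conductor_mul_differentIdeal ℤ ℚ K θ htop
  rw [hder] at hcond
  refine NumberField.squarefree_discr_of_forall_exists_int_sub_mem K
    (Ideal.exists_int_sub_mem_of_mul_eq_span_singleton ?_ hcond fun x hx ↦
      exists_int_sub_mem_span_of_pow_eq_add_one hn hθ (conductor_subset_adjoin hx))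
  rw [← hder]
  intro h0
  have := (Algebra.IsSeparable.isSeparable ℚ α).aeval_derivative_ne_zero (minpoly.aeval ℚ α)
  apply this
  rw [← hθα, minpoly.isIntegrallyClosed_eq_field_fractions ℚ K
      (NumberField.RingOfIntegers.isIntegral θ), derivative_map, aeval_map_algebraMap,
      aeval_algebraMap_apply, h0, map_zero]
end

section
/- For every integer n ≥ 2, the Galois group of the splitting field of X^n − X − 1 over ℚ is isomorphic to the symmetric group S_n, i.e. there is a group isomorphism Gal(SplittingField(X^n − X − 1)/ℚ) ≅ Equiv.Perm(Fin n). -/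
open Polynomial
open scoped NumberField

/-- By Minkowski's theorem, the Galois group of a number field is generated by its inertia
subgroups. -/
theorem NumberField.iSup_inertia_eq_top (K : Type*) [Field K] [NumberField K] [IsGalois ℚ K] :
    ⨆ m : MaximalSpectrum (𝓞 K), m.asIdeal.inertia Gal(K/ℚ) = ⊤ := by
  set H := ⨆ m : MaximalSpectrum (𝓞 K), m.asIdeal.inertia Gal(K/ℚ)
  let F : IntermediateField ℚ K := FixedPoints.intermediateField H
  have : IsGaloisGroup H F K := IsGaloisGroup.subgroup Gal(K/ℚ) ℚ K H
  have : IsGaloisGroup H (𝓞 F) (𝓞 K) := .of_isFractionRing H (𝓞 F) (𝓞 K) F K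
  have : IsGaloisGroup Gal(K/ℚ) ℤ (𝓞 K) := .of_isFractionRing Gal(K/ℚ) ℤ (𝓞 K) ℚ K
  have hF : Module.finrank ℚ F = 1 := by
    by_contra h
    obtain ⟨p, hp, hpr⟩ := NumberField.exists_not_isUnramifiedAt_int (K := F) (𝒪 := 𝓞 F) h
    apply hpr
    rw [← Ideal.ramificationIdx_eq_one_iff]
    have hp0 : p ≠ ⊥ := Ring.ne_bot_of_isMaximal_of_not_isField hp (RingOfIntegers.not_isField F)
    obtain ⟨P, hP, hPp⟩ := Ideal.exists_maximal_ideal_liesOver_of_isIntegral (S := 𝓞 K) p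
    have h1 : Nat.card (P.inertia Gal(K/ℚ)) = P.ramificationIdx ℤ := by
      have hP0 : P.under ℤ ≠ ⊥ := Ideal.IsMaximal.ne_bot_of_isIntegral_int _
      have : Finite (ℤ ⧸ P.under ℤ) := Ring.HasFiniteQuotients.finiteQuotient hP0
      rw [Ideal.card_inertia_eq_ramificationIdxIn (P.under ℤ) P,
        Ideal.ramificationIdxIn_eq_ramificationIdx (P.under ℤ) P Gal(K/ℚ)]
    have h2 : Nat.card (P.inertia H) = P.ramificationIdx (𝓞 F) := by
      have : Finite (𝓞 F ⧸ p) := Ring.HasFiniteQuotients.finiteQuotient hp0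
      rw [Ideal.card_inertia_eq_ramificationIdxIn p P,
        Ideal.ramificationIdxIn_eq_ramificationIdx p P H]
    have h3 : Nat.card (P.inertia H) = Nat.card (P.inertia Gal(K/ℚ)) := by
      have hle : P.inertia Gal(K/ℚ) ≤ H :=
        le_iSup (fun m : MaximalSpectrum (𝓞 K) ↦ m.asIdeal.inertia Gal(K/ℚ)) ⟨P, hP⟩
      exact Nat.card_congr (Subgroup.subgroupOfEquivOfLe hle).toEquiv
    have h4 := Ideal.ramificationIdx_tower (R := ℤ) p P
    rw [← h1, ← h2, h3] at h4
    exact (right_eq_mul₀ Nat.card_pos.ne').mp h4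
  have hcard : Nat.card H = Nat.card Gal(K/ℚ) := by
    rw [IsGaloisGroup.card_eq_finrank H F K, IsGaloisGroup.card_eq_finrank Gal(K/ℚ) ℚ K,
      ← Module.finrank_mul_finrank ℚ F K, hF, one_mul]
  exact Subgroup.eq_top_of_card_eq H hcard

namespace Polynomial

theorem X_pow_sub_X_sub_one_monic (R : Type*) [CommRing R] [Nontrivial R] {n : ℕ} (hn : 2 ≤ n) :
    (X ^ n - X - 1 : R[X]).Monic := by
  rw [sub_sub]
  refine monic_X_pow_sub ?_
  rw [← C_1, degree_X_add_C]
  exact_mod_cast hn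

theorem natDegree_X_pow_sub_X_sub_one (R : Type*) [CommRing R] [Nontrivial R] {n : ℕ}
    (hn : 2 ≤ n) : (X ^ n - X - 1 : R[X]).natDegree = n := by
  rw [sub_sub, natDegree_sub_eq_left_of_natDegree_lt, natDegree_X_pow]
  rw [← C_1, natDegree_X_add_C, natDegree_X_pow]
  exact hn

/-- At most one root of `X ^ n - X - 1` in a domain is multiple, and its multiplicity is then two. -/
theorem card_roots_X_pow_sub_X_sub_one_le {k : Type*} [CommRing k] [IsDomain k] [DecidableEq k]
    {n : ℕ} (hn : 2 ≤ n) :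
    (X ^ n - X - 1 : k[X]).roots.card ≤ (X ^ n - X - 1 : k[X]).roots.toFinset.card + 1 := by
  set f : k[X] := X ^ n - X - 1 with hf
  have hf0 : f ≠ 0 := (X_pow_sub_X_sub_one_monic k hn).ne_zero
  obtain ⟨m, rfl⟩ := Nat.exists_eq_add_of_le' hn
  have hmult {x : k} (hx : 1 < f.roots.count x) :
      ((m : k) + 2) * x ^ (m + 1) = 1 ∧ ((m : k) + 1) * x = -((m : k) + 2) := by
    rw [count_roots, one_lt_rootMultiplicity_iff_isRoot hf0] at hx
    obtain ⟨h1, h2⟩ := hx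
    simp [hf] at h1 h2
    constructor
    · linear_combination h2
    · linear_combination h2 * x - (m + 2) * h1
  have hm {x : k} (hx : 1 < f.roots.count x) : (m : k) + 1 ≠ 0 := by
    intro h
    obtain ⟨h1, h2⟩ := hmult hx
    rw [h, zero_mul, zero_eq_neg] at h2
    exact one_ne_zero (α := k) (by linear_combination h2 - h)
  have huniq {x y : k} (hx : 1 < f.roots.count x) (hy : 1 < f.roots.count y) : x = y :=
    mul_left_cancel₀ (hm hx) ((hmult hx).2.trans (hmult hy).2.symm)
  have hle (x : k) : f.roots.count x ≤ 2 := by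
    by_contra! hx
    obtain ⟨h1, h2⟩ := hmult (x := x) (by lia)
    rw [count_roots] at hx
    have h3 := isRoot_iterate_derivative_of_lt_rootMultiplicity hx
    simp [hf] at h3
    have hn0 : (m : k) + 2 ≠ 0 := left_ne_zero_of_mul (h1 ▸ one_ne_zero)
    have hx0 : x ≠ 0 := by
      rintro rfl
      simp at h1
    have := hm (x := x) (by rw [count_roots]; lia)
    have h4 : (m : k) + 1 + 1 ≠ 0 := by rwa [add_assoc, one_add_one_eq_two]
    simp_all
  rw [Multiset.card_toFinset]
  by_cases h : ∃ x, 1 < f.roots.count x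
  · obtain ⟨x, hx⟩ := h
    rw [← Multiset.card_singleton x, ← Multiset.card_add]
    refine Multiset.card_le_card (Multiset.le_iff_count.mpr fun y ↦ ?_)
    rw [Multiset.count_add, Multiset.count_dedup, Multiset.count_singleton]
    have := Multiset.one_le_count_iff_mem (a := y) (s := f.roots)
    have := hle y
    have := @huniq x y hx
    split_ifs <;> grind
  · push Not at h
    rw [Multiset.dedup_eq_self.mpr (Multiset.nodup_iff_count_le_one.mpr h)]
    lia

/-- The Galois group of any splitting field of `X ^ n - X - 1` over `ℚ` is the full symmetric
group. -/
theorem nonempty_gal_mulEquiv_perm_of_isSplittingField {n : ℕ} (hn : 2 ≤ n) (K : Type*) [Field K]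
    [CharZero K] [A : Algebra ℚ K] [IsSplittingField ℚ K (X ^ n - X - 1)] :
    Nonempty (Gal(K/ℚ) ≃* Equiv.Perm (Fin n)) := by
  classical
  obtain rfl : A = DivisionRing.toRatAlgebra := Subsingleton.elim _ _
  set f : ℚ[X] := X ^ n - X - 1 with hf
  let g : ℤ[X] := X ^ n - X - 1
  have hirr : Irreducible f := X_pow_sub_X_sub_one_irreducible_rat (by lia)
  have hmap {R : Type _} [CommRing R] [Algebra ℤ R] : g.map (algebraMap ℤ R) = X ^ n - X - 1 := by
    simp [g]
  have : NumberField K := { to_finiteDimensional := IsSplittingField.finiteDimensional K f }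
  have : IsGalois ℚ K := .of_separable_splitting_field (p := f) hirr.separable
  have hgK : g.map (algebraMap ℤ K) = f.map (algebraMap ℚ K) := by simp [g, hf]
  have hroot : g.rootSet K = f.rootSet K := by
    rw [rootSet_def, rootSet_def, aroots_def, aroots_def, hgK]
  have hinj : Function.Injective (algebraMap (𝓞 K) K) := NumberField.RingOfIntegers.coe_injective
  have hsplit : (g.map (algebraMap ℤ (𝓞 K))).Splits := by
    refine .of_splits_map_of_injective (i := algebraMap (𝓞 K) K) hinj ?_ ?_
    · rw [map_map, ← IsScalarTower.algebraMap_eq, hgK]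
      exact IsSplittingField.splits K f
    · intro a ha
      rw [map_map, ← IsScalarTower.algebraMap_eq, mem_roots', IsRoot.def, eval_map_algebraMap] at ha
      exact ⟨⟨a, g, X_pow_sub_X_sub_one_monic ℤ hn, ha.2⟩, rfl⟩
  have himage : algebraMap (𝓞 K) K '' g.rootSet (𝓞 K) = f.rootSet K := by
    rw [hsplit.image_rootSet_algebraMap, hroot]
  have hcard : (g.rootSet (𝓞 K)).ncard = n := by
    rw [← Set.ncard_image_of_injective _ hinj, himage, ← Nat.card_coe_set_eq,
      Nat.card_eq_fintype_card,
      card_rootSet_eq_natDegree hirr.separable (IsSplittingField.splits K f),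
      natDegree_X_pow_sub_X_sub_one ℚ hn]
  have hcoll (m : MaximalSpectrum (𝓞 K)) :
      (g.rootSet (𝓞 K)).ncard ≤ (g.rootSet (𝓞 K ⧸ m.asIdeal)).ncard + 1 := by
    have := m.isMaximal
    have hs : (g.map (algebraMap ℤ (𝓞 K ⧸ m.asIdeal))).Splits := by
      rw [IsScalarTower.algebraMap_eq ℤ (𝓞 K), ← map_map]
      exact hsplit.map _
    have h := hs.natDegree_eq_card_roots
    rw [hmap, natDegree_X_pow_sub_X_sub_one _ hn] at h
    rw [hcard, rootSet_def, Set.ncard_coe_finset, aroots_def, hmap]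
    exact h.trans_le (card_roots_X_pow_sub_X_sub_one_le hn)
  have htrans : MulAction.IsPretransitive Gal(K/ℚ) (g.rootSet (𝓞 K)) := by
    refine ⟨fun x y ↦ ?_⟩
    have hx : algebraMap (𝓞 K) K x ∈ f.rootSet K := himage ▸ Set.mem_image_of_mem _ x.2
    have hy : algebraMap (𝓞 K) K y ∈ f.rootSet K := himage ▸ Set.mem_image_of_mem _ y.2
    have hx' := minpoly.eq_of_irreducible hirr (mem_rootSet.mp hx).2
    have hy' := minpoly.eq_of_irreducible hirr (mem_rootSet.mp hy).2
    obtain ⟨σ, hσ⟩ := (Normal.minpoly_eq_iff_mem_orbit K).mp (hy'.symm.trans hx')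
    exact ⟨σ, Subtype.ext (hinj hσ)⟩
  have hsurj := hsplit.surjective_toPermHom_of_iSup_inertia_eq_top hcoll
    (NumberField.iSup_inertia_eq_top K)
  have hinj' : Function.Injective (MulAction.toPermHom Gal(K/ℚ) (g.rootSet (𝓞 K))) := by
    intro σ τ h
    have hadj := IsSplittingField.adjoin_rootSet K f
    refine AlgEquiv.coe_toAlgHom_injective (AlgHom.ext_of_adjoin_eq_top hadj fun x hx ↦ ?_)
    obtain ⟨y, hy, rfl⟩ := himage.symm ▸ hx
    exact congrArg (algebraMap (𝓞 K) K) (congrArg Subtype.val (Equiv.congr_fun h ⟨y, hy⟩))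
  have e : g.rootSet (𝓞 K) ≃ Fin n := Finite.equivFinOfCardEq hcard
  exact ⟨(MulEquiv.ofBijective _ ⟨hinj', hsurj⟩).trans e.permCongrHom⟩

end Polynomial

/-- For every integer `n ≥ 2`, the Galois group of the splitting field of `X^n - X - 1`
over `ℚ` is isomorphic to the symmetric group `S_n`. -/
theorem gal_selmer_poly_eq_symm_group (n : ℕ) (hn : 2 ≤ n) :
    Nonempty ((X ^ n - X - 1 : ℚ[X]).Gal ≃* Equiv.Perm (Fin n)) :=
  @Polynomial.nonempty_gal_mulEquiv_perm_of_isSplittingField n hn _ _ _ _ (.splittingField _)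
end

section
/- The splitting field of f_5 := X^5 − X − 1 over ℚ and the splitting field of g := X^6 − X^5 − 10X^4 + 30X^3 − 31X^2 + 7X + 9 over ℚ are isomorphic as ℚ-algebras; equivalently, the splitting field of f_5 over ℚ is also a splitting field of g over ℚ. -/
open Polynomial

theorem irreducible_sextic_zmod_two :
    Irreducible (X ^ 6 + X ^ 5 + X ^ 2 + X + 1 : (ZMod 2)[X]) := by
  obtain ⟨p, hp⟩ : ∃ p : (ZMod 2)[X], p = X ^ 6 + X ^ 5 + X ^ 2 + X + 1 := ⟨_, rfl⟩
  have hdeg : p.natDegree = 6 := by rw [hp]; compute_degree!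
  have hmonic : p.Monic := by rw [hp]; monicity!
  rw [← hp, hmonic.irreducible_iff_lt_natDegree_lt (by rintro rfl; simp at hdeg)]
  rintro q hq hqd ⟨r, rfl⟩
  have hr : r.Monic := hq.of_mul_monic_left hmonic
  rw [hdeg, Finset.mem_Ioc] at hqd
  have hqr := hq.natDegree_mul hr
  rw [hdeg] at hqr
  have hq1 := hq.coeff_natDegree
  have hr1 := hr.coeff_natDegree
  have hq0 : ∀ n, q.natDegree < n → q.coeff n = 0 := fun n hn => coeff_eq_zero_of_natDegree_lt hn
  have hr0 : ∀ n, r.natDegree < n → r.coeff n = 0 := fun n hn => coeff_eq_zero_of_natDegree_lt hn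
  have hc : ∀ n, ∑ i ∈ Finset.range (n + 1), q.coeff i * r.coeff (n - i) =
      (X ^ 6 + X ^ 5 + X ^ 2 + X + 1 : (ZMod 2)[X]).coeff n := fun n => by
    rw [← hp, coeff_mul, Finset.Nat.sum_antidiagonal_eq_sum_range_succ_mk]
  have c0 := hc 0
  have c1 := hc 1
  have c2 := hc 2
  have c3 := hc 3
  have c4 := hc 4
  have c5 := hc 5
  simp [Finset.sum_range_succ, coeff_X, coeff_one] at c0 c1 c2 c3 c4 c5
  obtain ⟨h1, h2⟩ := hqd
  have hdq : q.natDegree = 1 ∨ q.natDegree = 2 ∨ q.natDegree = 3 := by omega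
  clear hp hc
  rcases hdq with hd | hd | hd
  · have hd' : r.natDegree = 5 := by omega
    rw [hd] at hq1 hq0
    rw [hd'] at hr1 hr0
    simp [hq0, hq1, hr1] at c0 c1 c2 c3 c4 c5
    revert c0 c1 c2 c3 c4 c5
    generalize q.coeff 0 = a0, r.coeff 0 = b0, r.coeff 1 = b1,
      r.coeff 2 = b2, r.coeff 3 = b3, r.coeff 4 = b4
    revert a0 b0 b1 b2 b3 b4
    decide
  · have hd' : r.natDegree = 4 := by omega
    rw [hd] at hq1 hq0
    rw [hd'] at hr1 hr0
    simp [hq0, hr0, hq1, hr1] at c0 c1 c2 c3 c4 c5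
    revert c0 c1 c2 c3 c4 c5
    generalize q.coeff 0 = a0, q.coeff 1 = a1, r.coeff 0 = b0, r.coeff 1 = b1,
      r.coeff 2 = b2, r.coeff 3 = b3
    revert a0 a1 b0 b1 b2 b3
    decide
  · have hd' : r.natDegree = 3 := by omega
    rw [hd] at hq1 hq0
    rw [hd'] at hr1 hr0
    simp [hq0, hr0, hq1, hr1] at c0 c1 c2 c3 c4 c5
    revert c0 c1 c2 c3 c4 c5
    generalize q.coeff 0 = a0, q.coeff 1 = a1, q.coeff 2 = a2,
      r.coeff 0 = b0, r.coeff 1 = b1, r.coeff 2 = b2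
    revert a0 a1 a2 b0 b1 b2
    decide

theorem irreducible_sextic : Irreducible
    (X ^ 6 - X ^ 5 - 10 * X ^ 4 + 30 * X ^ 3 - 31 * X ^ 2 + 7 * X + 9 : ℚ[X]) := by
  obtain ⟨p, hp⟩ : ∃ p : ℤ[X],
      p = X ^ 6 - X ^ 5 - 10 * X ^ 4 + 30 * X ^ 3 - 31 * X ^ 2 + 7 * X + 9 := ⟨_, rfl⟩
  have hmonic : p.Monic := by rw [hp]; monicity!
  have hirr : Irreducible p := by
    refine hmonic.irreducible_of_irreducible_map (Int.castRingHom (ZMod 2)) _ ?_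
    convert irreducible_sextic_zmod_two using 1
    have h2 : (2 : (ZMod 2)[X]) = 0 := CharTwo.two_eq_zero
    simp only [hp, Polynomial.map_add, Polynomial.map_sub, Polynomial.map_mul, Polynomial.map_pow,
      map_X, Polynomial.map_ofNat]
    linear_combination (-X ^ 5 - 5 * X ^ 4 + 15 * X ^ 3 - 16 * X ^ 2 + 3 * X + 4) * h2
  rw [IsPrimitive.Int.irreducible_iff_irreducible_map_cast hmonic.isPrimitive, hp] at hirr
  simpa only [Polynomial.map_add, Polynomial.map_sub, Polynomial.map_mul, Polynomial.map_pow,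
    map_X, Polynomial.map_ofNat] using hirr

/-- The difference between the sum of products along the pentagon `a b c d e` and the sum of
products along its diagonals. -/
def pentagonForm {R : Type*} [CommRing R] (a b c d e : R) : R :=
  a * b + b * c + c * d + d * e + e * a - (a * c + c * e + e * b + b * d + d * a)

/-- The Vandermonde product of five elements. -/
def vandermondeFive {R : Type*} [CommRing R] (a b c d e : R) : R :=
  (a - b) * (a - c) * (a - d) * (a - e) * (b - c) * (b - d) * (b - e) * (c - d) * (c - e) * (d - e)

theorem pentagonForm_resolvent {R : Type*} [Field R] [CharZero R] {a b c d e e2 e3 e4 e5 : R}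
    (h1 : a + b + c + d + e = 0)
    (h2 : a * b + a * c + a * d + a * e + b * c + b * d + b * e + c * d + c * e + d * e = e2)
    (h3 : a * b * c + a * b * d + a * b * e + a * c * d + a * c * e + a * d * e + b * c * d +
      b * c * e + b * d * e + c * d * e = e3)
    (h4 : a * b * c * d + a * b * c * e + a * b * d * e + a * c * d * e + b * c * d * e = e4)
    (h5 : a * b * c * d * e = e5) :
    pentagonForm a b c d e ^ 6 - (20 * e4 + 3 * e2 ^ 2) * pentagonForm a b c d e ^ 4 +
      (240 * e4 ^ 2 - 400 * e3 * e5 + 16 * e2 * e3 ^ 2 - 8 * e2 ^ 2 * e4 + 3 * e2 ^ 4) *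
        pentagonForm a b c d e ^ 2 +
      (320 * e4 ^ 3 - 1600 * e3 * e4 * e5 - 64 * e3 ^ 4 + 4000 * e2 * e5 ^ 2 +
        224 * e2 * e3 ^ 2 * e4 - 176 * e2 ^ 2 * e4 ^ 2 - 80 * e2 ^ 2 * e3 * e5 -
        16 * e2 ^ 3 * e3 ^ 2 + 28 * e2 ^ 4 * e4 - e2 ^ 6) =
    32 * (vandermondeFive a b c d e * pentagonForm a b c d e) := by
  obtain ⟨t, k, f, g, rfl, rfl, rfl, rfl, rfl⟩ : ∃ t k f g : R, a = 4 * t ∧ b = k - t + f ∧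
      c = -k - t + g ∧ d = -k - t - g ∧ e = k - t - f := by
    refine ⟨a / 4, (b + e - c - d) / 4, (b - e) / 2, (c - d) / 2, ?_, ?_, ?_, ?_, ?_⟩
    · ring
    · linear_combination h1 / 4
    · linear_combination h1 / 4
    · linear_combination h1 / 4
    · linear_combination h1 / 4
  subst h2 h3 h4 h5
  unfold pentagonForm vandermondeFive
  ring

/-- Vieta's relations for `a, b, c, d, e` to be the roots of `X ^ 5 - X - 1`. -/
structure VietaFive {R : Type*} [CommRing R] (a b c d e : R) : Prop where
  esymm_one : a + b + c + d + e = 0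
  esymm_two : a * b + a * c + a * d + a * e + b * c + b * d + b * e + c * d + c * e + d * e = 0
  esymm_three : a * b * c + a * b * d + a * b * e + a * c * d + a * c * e + a * d * e + b * c * d +
    b * c * e + b * d * e + c * d * e = 0
  esymm_four : a * b * c * d + a * b * c * e + a * b * d * e + a * c * d * e + b * c * d * e = -1
  esymm_five : a * b * c * d * e = 1

namespace VietaFive

variable {R : Type*} [CommRing R] {a b c d e : R}

theorem swap (h : VietaFive a b c d e) : VietaFive b a c d e := by
  obtain ⟨h1, h2, h3, h4, h5⟩ := h
  constructor
  · linear_combination h1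
  · linear_combination h2
  · linear_combination h3
  · linear_combination h4
  · linear_combination h5

theorem rotate (h : VietaFive a b c d e) : VietaFive b c d e a := by
  obtain ⟨h1, h2, h3, h4, h5⟩ := h
  constructor
  · linear_combination h1
  · linear_combination h2
  · linear_combination h3
  · linear_combination h4
  · linear_combination h5

theorem rotate_last (h : VietaFive a b c d e) : VietaFive a b d e c := by
  obtain ⟨h1, h2, h3, h4, h5⟩ := h
  constructor
  · linear_combination h1
  · linear_combination h2
  · linear_combination h3
  · linear_combination h4
  · linear_combination h5

theorem rotate_tail (h : VietaFive a b c d e) : VietaFive a c d e b := h.swap.rotate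

theorem prod_sub (h : VietaFive a b c d e) :
    (a - b) * (a - c) * (a - d) * (a - e) = 5 * a ^ 4 - 1 := by
  obtain ⟨h1, h2, h3, h4, h5⟩ := h
  linear_combination h4 - 2 * a * h3 + 3 * a ^ 2 * h2 - 4 * a ^ 3 * h1

theorem root (h : VietaFive a b c d e) : a ^ 5 = a + 1 := by
  obtain ⟨h1, h2, h3, h4, h5⟩ := h
  linear_combination a ^ 4 * h1 - a ^ 3 * h2 + a ^ 2 * h3 - a * h4 + h5

theorem vandermonde_sq (h : VietaFive a b c d e) : vandermondeFive a b c d e ^ 2 = 2869 := by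
  have key : ∀ {a b c d e : R}, VietaFive a b c d e →
      a * ((a - b) * (a - c) * (a - d) * (a - e)) = 4 * a + 5 := fun h => by
    rw [h.prod_sub]; linear_combination 5 * h.root
  have regroup : ∀ p q r s t u v w x y : R, (p * q * r * s * t * u * v * w * x * y) ^ 2 *
      (a * b * c * d * e) =
        (a * (p * q * r * s)) * (b * (t * u * v * -p)) *
        (c * (w * x * -q * -t)) * (d * (y * -r * -u * -w)) * (e * (-s * -v * -x * -y)) := by
    intros; ring
  have hV := regroup (a - b) (a - c) (a - d) (a - e) (b - c) (b - d) (b - e) (c - d) (c - e) (d - e)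
  simp only [neg_sub] at hV
  rw [key h, key h.rotate, key h.rotate.rotate, key h.rotate.rotate.rotate,
    key h.rotate.rotate.rotate.rotate, h.esymm_five, mul_one] at hV
  rw [vandermondeFive, hV]
  linear_combination 1024 * h.esymm_five + 1280 * h.esymm_four + 1600 * h.esymm_three +
    2000 * h.esymm_two + 2500 * h.esymm_one

theorem sum_pentagonForm_mul (h : VietaFive a b c d e) :
    pentagonForm a b c d e * pentagonForm a c b e d +
      pentagonForm a b d e c * pentagonForm a d b c e +
      pentagonForm a b e c d * pentagonForm a c d b e = 40 * a ^ 4 - 28 := by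
  obtain ⟨h1, h2, h3, h4, -⟩ := h
  obtain rfl : e = -(a + b + c + d) := by linear_combination h1
  unfold pentagonForm
  linear_combination 28 * h4 - 36 * a * h3 + (44 * a ^ 2 +
    (a * b + a * c + a * d + b * c + b * d + c * d - (a + b + c + d) ^ 2)) * h2

end VietaFive

section CharZero

variable {K : Type*} [Field K] [CharZero K] {a b c d e : K}

theorem VietaFive.pentagonForm_sextic (h : VietaFive a b c d e) :
    pentagonForm a b c d e ^ 6 + 20 * pentagonForm a b c d e ^ 4 +
      240 * pentagonForm a b c d e ^ 2 - 320 =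
    32 * (vandermondeFive a b c d e * pentagonForm a b c d e) := by
  have key := pentagonForm_resolvent h.esymm_one rfl rfl rfl rfl
  rw [h.esymm_two, h.esymm_three, h.esymm_four] at key
  linear_combination key

theorem VietaFive.sextic_eq_zero (h : VietaFive a b c d e) {v : K}
    (hv : 4 * v = pentagonForm a b c d e ^ 2) :
    v ^ 6 + 10 * v ^ 5 + 55 * v ^ 4 + 140 * v ^ 3 + 175 * v ^ 2 - 3019 * v + 25 = 0 := by
  have h1 : 2 * (v ^ 3 + 5 * v ^ 2 + 15 * v - 5) =
      vandermondeFive a b c d e * pentagonForm a b c d e := by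
    have := h.pentagonForm_sextic
    rw [show pentagonForm a b c d e ^ 6 = (4 * v) ^ 3 by rw [hv]; ring,
      show pentagonForm a b c d e ^ 4 = (4 * v) ^ 2 by rw [hv]; ring, ← hv] at this
    linear_combination this / 32
  have h2 : (2 * (v ^ 3 + 5 * v ^ 2 + 15 * v - 5)) ^ 2 = 2869 * (4 * v) := by
    rw [h1, mul_pow, h.vandermonde_sq, hv]
  linear_combination h2 / 4

theorem exists_root_of_sextic_eq_zero {v : K}
    (hv : v ^ 6 + 10 * v ^ 5 + 55 * v ^ 4 + 140 * v ^ 3 + 175 * v ^ 2 - 3019 * v + 25 = 0) :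
    ∃ θ : K, θ ^ 6 - θ ^ 5 - 10 * θ ^ 4 + 30 * θ ^ 3 - 31 * θ ^ 2 + 7 * θ + 9 = 0 ∧
      θ ^ 5 - 10 * θ ^ 3 + 20 * θ ^ 2 - 11 * θ - 5 = v := by
  obtain ⟨θ, h1⟩ : ∃ θ : K,
      θ = (v ^ 5 + 9 * v ^ 4 + 46 * v ^ 3 + 94 * v ^ 2 + 81 * v - 2475) / 625 := ⟨_, rfl⟩
  have h2 : θ ^ 2 = (9800 - 523 * v - 472 * v ^ 2 - 178 * v ^ 3 - 32 * v ^ 4 - 3 * v ^ 5) / 625 := by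
    rw [h1]
    linear_combination (25 + 56 * v + 38 * v ^ 2 + 8 * v ^ 3 + v ^ 4) / 390625 * hv
  have h3 : θ ^ 3 = (-38800 + 2388 * v + 1777 * v ^ 2 + 703 * v ^ 3 + 127 * v ^ 4 +
      13 * v ^ 5) / 625 := by
    rw [pow_succ, h2, h1]
    linear_combination (-200 - 323 * v - 149 * v ^ 2 - 29 * v ^ 3 - 3 * v ^ 4) / 390625 * hv
  have h4 : θ ^ 4 = (153600 - 8736 * v - 7184 * v ^ 2 - 2811 * v ^ 3 - 514 * v ^ 4 -
      51 * v ^ 5) / 625 := by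
    rw [pow_succ, h3, h1]
    linear_combination (1200 + 1188 * v + 589 * v ^ 2 + 114 * v ^ 3 + 13 * v ^ 4) / 390625 * hv
  have h5 : θ ^ 5 = (-608100 + 35856 * v + 28244 * v ^ 2 + 11096 * v ^ 3 + 2009 * v ^ 4 +
      201 * v ^ 5) / 625 := by
    rw [pow_succ, h4, h1]
    linear_combination (-3900 - 4836 * v - 2348 * v ^ 2 - 463 * v ^ 3 - 51 * v ^ 4) / 390625 * hv
  have h6 : θ ^ 6 = (2407400 - 139924 * v - 112196 * v ^ 2 - 43944 * v ^ 3 - 7996 * v ^ 4 -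
      799 * v ^ 5) / 625 := by
    rw [pow_succ, h5, h1]
    linear_combination (16900 + 18956 * v + 9288 * v ^ 2 + 1808 * v ^ 3 + 201 * v ^ 4) / 390625 * hv
  refine ⟨θ, ?_, ?_⟩
  · rw [h6, h5, h4, h3, h2, h1]; ring
  · rw [h5, h3, h2, h1]; ring

theorem VietaFive.mem_of_forall_root_mem (h : VietaFive a b c d e) (F : Subfield K)
    (hF : ∀ θ : K, θ ^ 6 - θ ^ 5 - 10 * θ ^ 4 + 30 * θ ^ 3 - 31 * θ ^ 2 + 7 * θ + 9 = 0 → θ ∈ F) :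
    a ∈ F := by
  have nat_mem (n : ℕ) [n.AtLeastTwo] : (OfNat.ofNat n : K) ∈ F := ofNat_mem F n
  have hV : ∀ {a b c d e : K}, VietaFive a b c d e →
      vandermondeFive a b c d e * pentagonForm a b c d e ∈ F := fun {a b c d e} h => by
    have hv : 4 * (pentagonForm a b c d e ^ 2 / 4) = pentagonForm a b c d e ^ 2 := by ring
    obtain ⟨θ, hθ, hθv⟩ := exists_root_of_sextic_eq_zero (h.sextic_eq_zero hv)
    have hθF := hF θ hθ
    have hsq : pentagonForm a b c d e ^ 2 ∈ F := by
      rw [← hv, ← hθv]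
      refine mul_mem (nat_mem 4) (sub_mem (sub_mem (add_mem (sub_mem ?_ ?_) ?_) ?_) (nat_mem 5))
      · exact pow_mem hθF 5
      · exact mul_mem (nat_mem 10) (pow_mem hθF 3)
      · exact mul_mem (nat_mem 20) (pow_mem hθF 2)
      · exact mul_mem (nat_mem 11) hθF
    have : vandermondeFive a b c d e * pentagonForm a b c d e =
        ((pentagonForm a b c d e ^ 2) ^ 3 + 20 * (pentagonForm a b c d e ^ 2) ^ 2 +
          240 * pentagonForm a b c d e ^ 2 - 320) / 32 := by
      linear_combination -h.pentagonForm_sextic / 32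
    rw [this]
    refine div_mem (sub_mem (add_mem (add_mem ?_ ?_) ?_) (nat_mem 320)) (nat_mem 32)
    · exact pow_mem hsq 3
    · exact mul_mem (nat_mem 20) (pow_mem hsq 2)
    · exact mul_mem (nat_mem 240) hsq
  have hpow : a ^ 4 = ((
      (vandermondeFive a b c d e * pentagonForm a b c d e) *
        (vandermondeFive a c b e d * pentagonForm a c b e d) +
      (vandermondeFive a b d e c * pentagonForm a b d e c) *
        (vandermondeFive a d b c e * pentagonForm a d b c e) +
      (vandermondeFive a b e c d * pentagonForm a b e c d) *
        (vandermondeFive a c d b e * pentagonForm a c d b e)) / 2869 + 28) / 40 := by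
    have e1 : vandermondeFive a c b e d = vandermondeFive a b c d e := by
      unfold vandermondeFive; ring
    have e2 : vandermondeFive a b d e c = vandermondeFive a b c d e := by
      unfold vandermondeFive; ring
    have e3 : vandermondeFive a d b c e = vandermondeFive a b c d e := by
      unfold vandermondeFive; ring
    have e4 : vandermondeFive a b e c d = vandermondeFive a b c d e := by
      unfold vandermondeFive; ring
    have e5 : vandermondeFive a c d b e = vandermondeFive a b c d e := by
      unfold vandermondeFive; ring
    rw [e1, e2, e3, e4, e5]
    linear_combination -(40 * a ^ 4 - 28) / (40 * 2869) * h.vandermonde_sq -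
      vandermondeFive a b c d e ^ 2 / (40 * 2869) * h.sum_pentagonForm_mul
  have hbec := h.rotate_last.rotate_last
  have hcdb := hbec.rotate_tail.rotate_tail
  have ha4 : a ^ 4 ∈ F := by
    rw [hpow]
    refine div_mem (add_mem (div_mem (add_mem (add_mem ?_ ?_) ?_) (nat_mem 2869)) (nat_mem 28))
      (nat_mem 40)
    · exact mul_mem (hV h) (hV hcdb.rotate_last)
    · exact mul_mem (hV h.rotate_last) (hV h.rotate_tail.rotate_tail.rotate_last)
    · exact mul_mem (hV hbec) (hV hcdb)
  have ha : a * (a ^ 4 - 1) = 1 := by linear_combination h.root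
  rw [eq_inv_of_mul_eq_one_left ha]
  exact inv_mem (sub_mem ha4 (one_mem F))

end CharZero

theorem VietaFive.of_prod_eq {R : Type*} [CommRing R] {a b c d e : R}
    (h : (X ^ 5 - X - 1 : R[X]) = (X - C a) * (X - C b) * (X - C c) * (X - C d) * (X - C e)) :
    VietaFive a b c d e := by
  have hexp : (X ^ 5 - X - 1 : R[X]) = X ^ 5 - C (a + b + c + d + e) * X ^ 4 +
      C (a * b + a * c + a * d + a * e + b * c + b * d + b * e + c * d + c * e + d * e) * X ^ 3 -
      C (a * b * c + a * b * d + a * b * e + a * c * d + a * c * e + a * d * e + b * c * d +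
        b * c * e + b * d * e + c * d * e) * X ^ 2 +
      C (a * b * c * d + a * b * c * e + a * b * d * e + a * c * d * e + b * c * d * e) * X -
      C (a * b * c * d * e) := by
    rw [h]
    simp only [map_add, map_mul]
    ring
  have hc := fun n => congrArg (coeff · n) hexp
  simp only [coeff_add, coeff_sub, coeff_C_mul, coeff_X_pow, coeff_X, coeff_one, coeff_C] at hc
  have h0 := hc 0
  have h1 := hc 1
  have h2 := hc 2
  have h3 := hc 3
  have h4 := hc 4
  norm_num at h0 h1 h2 h3 h4
  exact ⟨by linear_combination h4, by linear_combination -h3, by linear_combination h2,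
    by linear_combination -h1, by linear_combination -h0⟩

theorem exists_prod_of_splits {K : Type*} [Field K]
    (h : (X ^ 5 - X - 1 : K[X]).Splits) :
    ∃ a b c d e : K,
      (X ^ 5 - X - 1 : K[X]) = (X - C a) * (X - C b) * (X - C c) * (X - C d) * (X - C e) := by
  have hmonic : (X ^ 5 - X - 1 : K[X]).Monic := by monicity!
  have hdeg : (X ^ 5 - X - 1 : K[X]).natDegree = 5 := by compute_degree!
  have hcard := h.natDegree_eq_card_roots
  have hprod := h.eq_prod_roots_of_monic hmonic
  rw [hdeg] at hcard
  generalize (X ^ 5 - X - 1 : K[X]).roots = s at hcard hprod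
  induction s using Quotient.inductionOn with | _ l =>
  match l, hcard with
  | [a, b, c, d, e], _ => exact ⟨a, b, c, d, e, by rw [hprod]; simp [mul_assoc]⟩

theorem mem_rootSet_sextic {K : Type*} [Field K] [Algebra ℚ K] {θ : K} :
    θ ∈ (X ^ 6 - X ^ 5 - 10 * X ^ 4 + 30 * X ^ 3 - 31 * X ^ 2 + 7 * X + 9 : ℚ[X]).rootSet K ↔
      θ ^ 6 - θ ^ 5 - 10 * θ ^ 4 + 30 * θ ^ 3 - 31 * θ ^ 2 + 7 * θ + 9 = 0 := by
  rw [mem_rootSet_of_ne irreducible_sextic.ne_zero]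
  simp [aeval_def, eval₂_ofNat]

/-- A splitting field of `X ^ 5 - X - 1` over `ℚ` is also a splitting field of its sextic
resolvent. -/
theorem isSplittingField_sextic {K : Type*} [Field K] [Algebra ℚ K]
    [hK : IsSplittingField ℚ K (X ^ 5 - X - 1)] :
    IsSplittingField ℚ K
      (X ^ 6 - X ^ 5 - 10 * X ^ 4 + 30 * X ^ 3 - 31 * X ^ 2 + 7 * X + 9 : ℚ[X]) := by
  have : CharZero K := algebraRat.charZero K
  have hsplit := IsSplittingField.splits K (X ^ 5 - X - 1 : ℚ[X])
  have htop := (isSplittingField_iff_intermediateField.mp hK).2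
  have hnormal : Normal ℚ K := Normal.of_isSplittingField (X ^ 5 - X - 1 : ℚ[X])
  have hf0 : (X ^ 5 - X - 1 : ℚ[X]) ≠ 0 := (show Monic _ by monicity!).ne_zero
  have hroot : ∀ x ∈ (X ^ 5 - X - 1 : ℚ[X]).rootSet K,
      x ^ 5 - x - 1 = 0 := fun x hx => by
    simpa [aeval_def] using (mem_rootSet_of_ne hf0).mp hx
  rw [show (X ^ 5 - X - 1 : ℚ[X]).map (algebraMap ℚ K) = X ^ 5 - X - 1 by simp] at hsplit
  obtain ⟨a, b, c, d, e, hprod⟩ := exists_prod_of_splits hsplit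
  have h := VietaFive.of_prod_eq hprod
  rw [isSplittingField_iff_intermediateField]
  constructor
  · obtain ⟨θ, hθ, -⟩ := exists_root_of_sextic_eq_zero
      (h.sextic_eq_zero (v := pentagonForm a b c d e ^ 2 / 4) (by ring))
    have hmonic : (X ^ 6 - X ^ 5 - 10 * X ^ 4 + 30 * X ^ 3 - 31 * X ^ 2 + 7 * X + 9 :
        ℚ[X]).Monic := by
      monicity!
    rw [minpoly.eq_of_irreducible_of_monic irreducible_sextic
      (aeval_eq_zero_of_mem_rootSet (mem_rootSet_sextic.mpr hθ)) hmonic]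
    exact hnormal.splits θ
  · rw [eq_top_iff, ← htop, IntermediateField.adjoin_le_iff]
    intro x hx
    have hmem : ∀ {a b c d e : K}, VietaFive a b c d e →
        a ∈ IntermediateField.adjoin ℚ ((X ^ 6 - X ^ 5 - 10 * X ^ 4 + 30 * X ^ 3 - 31 * X ^ 2 +
          7 * X + 9 : ℚ[X]).rootSet K) := fun h =>
      h.mem_of_forall_root_mem (IntermediateField.adjoin ℚ _).toSubfield fun θ hθ =>
        IntermediateField.subset_adjoin _ _ (mem_rootSet_sextic.mpr hθ)
    have hx' : (x - a) * (x - b) * (x - c) * (x - d) * (x - e) = 0 := by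
      rw [← hroot x hx]
      simpa only [eval_sub, eval_mul, eval_pow, eval_X, eval_one, eval_C] using
        (congrArg (eval x) hprod).symm
    simp only [mul_eq_zero, sub_eq_zero] at hx'
    rcases hx' with (((rfl | rfl) | rfl) | rfl) | rfl
    · exact hmem h
    · exact hmem h.rotate
    · exact hmem h.rotate.rotate
    · exact hmem h.rotate.rotate.rotate
    · exact hmem h.rotate.rotate.rotate.rotate

/-- The splitting field of `f₅ = X^5 - X - 1` over `ℚ` is also a splitting field of
`g = X^6 - X^5 - 10X^4 + 30X^3 - 31X^2 + 7X + 9` over `ℚ`. -/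
theorem splittingField_f5_eq_splittingField_g :
    IsSplittingField ℚ (X ^ 5 - X - 1 : ℚ[X]).SplittingField
      (X ^ 6 - X ^ 5 - 10 * X ^ 4 + 30 * X ^ 3 - 31 * X ^ 2 + 7 * X + 9 : ℚ[X]) := by
  convert @isSplittingField_sextic _ _ (SplittingField.instAlgebra _)
    (IsSplittingField.splittingField (X ^ 5 - X - 1 : ℚ[X])) using 1
  exact Subsingleton.elim _ _
end

section
/- Let F̄₅ be an algebraic closure of 𝔽₅ = ℤ/5ℤ, fix ζ ∈ F̄₅ of multiplicative order 8 with ζ² = 2, and let G̃ ⊆ GL₂(F̄₅) be the subgroup generated by the image of SL₂(𝔽₅), the scalar matrix 2·I, and the matrix [[0, ζ], [−ζ⁻¹, 0]]. Then G̃ contains a subgroup of order 80, and any two subgroups of G̃ of order 80 are conjugate in G̃. -/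
open Matrix

theorem five_pow_factorization_five_mul {m : ℕ} (hm : ¬ 5 ∣ m) :
    5 ^ (5 * m).factorization 5 = 5 := by
  have hm0 : m ≠ 0 := by rintro rfl; simp at hm
  rw [Nat.factorization_mul (by norm_num) hm0, Finsupp.add_apply,
    Nat.Prime.factorization_self (by norm_num), Nat.factorization_eq_zero_of_not_dvd hm, add_zero,
    pow_one]

theorem eq_normalizer_sylow_of_card_eq_eighty {G : Type*} [Group G] (hG : Nat.card G = 480)
    (hn : Nat.card (Sylow 5 G) = 6) (H : Subgroup G) (hH : Nat.card H = 80) :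
    ∃ P : Sylow 5 G, H = Subgroup.normalizer (P : Set G) := by
  have : Fact (Nat.Prime 5) := ⟨by norm_num⟩
  have : Finite G := Nat.finite_of_card_ne_zero (by omega)
  have hle : Nat.card (Sylow 5 H) ≤ 6 := by
    rw [← hn]
    choose f hf using fun P : Sylow 5 H => P.exists_comap_subtype_eq
    refine Nat.card_le_card_of_injective f fun P Q h => Sylow.ext ?_
    rw [← hf P, ← hf Q, h]
  obtain ⟨Q⟩ : Nonempty (Sylow 5 H) := inferInstance
  have hcQ : Nat.card Q = 5 := by
    rw [Q.card_eq_multiplicity, hH, show (80 : ℕ) = 5 * 16 by norm_num,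
      five_pow_factorization_five_mul (by norm_num)]
  have hdvd := Q.card_dvd_index
  have hidx := Q.index_mul_card
  have hmod : _ % _ = _ % _ := card_sylow_modEq_one 5 H
  rw [hH, hcQ] at hidx
  rw [show (Q : Subgroup H).index = 16 by omega] at hdvd
  have hone : Nat.card (Sylow 5 H) = 1 := by
    interval_cases Nat.card (Sylow 5 H) <;> omega
  have : Subsingleton (Sylow 5 H) := (Nat.card_eq_one_iff_unique.mp hone).1
  have hQ := Q.normal_of_subsingleton
  obtain ⟨P, hP⟩ := Q.exists_comap_subtype_eq
  have hcP : Nat.card P = 5 := by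
    rw [P.card_eq_multiplicity, hG, show (480 : ℕ) = 5 * 96 by norm_num,
      five_pow_factorization_five_mul (by norm_num)]
  have hmap : (Q : Subgroup H).map H.subtype = P := by
    refine Subgroup.eq_of_le_of_card_ge ?_ ?_
    · rw [← hP]
      exact Subgroup.map_comap_le _ _
    · rw [Subgroup.card_map_of_injective H.subtype_injective]
      exact (hcP.trans hcQ.symm).le
  have hN : Nat.card (Subgroup.normalizer (P : Set G)) = 80 := by
    have h := (Subgroup.normalizer (P : Set G)).index_mul_card
    have h' := P.card_eq_index_normalizer
    rw [← h', hn, hG] at h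
    omega
  refine ⟨P, Subgroup.eq_of_le_of_card_ge ?_ (by rw [hN, hH])⟩
  have := Subgroup.le_normalizer_map (H := (Q : Subgroup H)) H.subtype
  rw [hmap, Subgroup.normalizer_eq_top, ← MonoidHom.range_eq_map, H.range_subtype] at this
  exact this

theorem card_sylow_five_eq_six {G : Type*} [Group G] (hG : Nat.card G = 480)
    (U : Subgroup G) (hU : Nat.card U = 5) (hnU : ¬ U.Normal)
    (hN : 80 ≤ Nat.card (Subgroup.normalizer (U : Set G))) : Nat.card (Sylow 5 G) = 6 := by
  have : Fact (Nat.Prime 5) := ⟨by norm_num⟩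
  have : Finite G := Nat.finite_of_card_ne_zero (by omega)
  let P : Sylow 5 G := Sylow.ofCard U <| by
    rw [hU, hG, show (480 : ℕ) = 5 * 96 by norm_num,
      five_pow_factorization_five_mul (by norm_num)]
  have h := (Subgroup.normalizer (U : Set G)).index_mul_card
  have h' : Nat.card (Sylow 5 G) = (Subgroup.normalizer (U : Set G)).index :=
    P.card_eq_index_normalizer
  have hmod : _ % _ = _ % _ := card_sylow_modEq_one 5 G
  rw [← h', hG] at h
  have h1 : Nat.card (Sylow 5 G) ≠ 1 := fun h1 => hnU <| by
    have : Subsingleton (Sylow 5 G) := (Nat.card_eq_one_iff_unique.mp h1).1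
    exact P.normal_of_subsingleton
  have h6 : Nat.card (Sylow 5 G) ≤ 6 := by nlinarith
  interval_cases Nat.card (Sylow 5 G) <;> omega

theorem exists_card_eq_eighty_and_conj {G : Type*} [Group G] (hG : Nat.card G = 480)
    (hn : Nat.card (Sylow 5 G) = 6) :
    (∃ H : Subgroup G, Nat.card H = 80) ∧
      ∀ H₁ H₂ : Subgroup G, Nat.card H₁ = 80 → Nat.card H₂ = 80 →
        ∃ g : G, Subgroup.map (MulAut.conj g).toMonoidHom H₁ = H₂ := by
  have : Fact (Nat.Prime 5) := ⟨by norm_num⟩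
  have : Finite G := Nat.finite_of_card_ne_zero (by omega)
  constructor
  · obtain ⟨P⟩ : Nonempty (Sylow 5 G) := inferInstance
    refine ⟨Subgroup.normalizer (P : Set G), ?_⟩
    have h := (Subgroup.normalizer (P : Set G)).index_mul_card
    have h' := P.card_eq_index_normalizer
    rw [← h', hn, hG] at h
    omega
  · intro H₁ H₂ h₁ h₂
    obtain ⟨P, rfl⟩ := eq_normalizer_sylow_of_card_eq_eighty hG hn H₁ h₁
    obtain ⟨Q, rfl⟩ := eq_normalizer_sylow_of_card_eq_eighty hG hn H₂ h₂
    obtain ⟨g, rfl⟩ := MulAction.exists_smul_eq G P Q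
    refine ⟨g, ?_⟩
    exact Subgroup.map_equiv_normalizer_eq (P : Subgroup G) (MulAut.conj g)

open scoped Classical in
/-- The image in `GL₂(F)` of a matrix over `𝔽₅`, multiplied by the scalar `c` when its determinant
is not a square. -/
noncomputable def twist {F : Type*} [Field F] [Algebra (ZMod 5) F] (c : Fˣ)
    (A : GL (Fin 2) (ZMod 5)) : GL (Fin 2) F :=
  if A.det ^ 2 = 1 then GeneralLinearGroup.map (algebraMap (ZMod 5) F) A
  else GeneralLinearGroup.scalar (Fin 2) c * GeneralLinearGroup.map (algebraMap (ZMod 5) F) A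

theorem units_zmod_five_sq_eq_neg_one {d : (ZMod 5)ˣ} : d ^ 2 ≠ 1 → d ^ 2 = -1 := by
  revert d; decide

theorem neg_one_ne_one_units_zmod_five : (-1 : (ZMod 5)ˣ) ≠ 1 := by decide

/-- The unit `2` of `ZMod 5`. -/
def unitTwo : (ZMod 5)ˣ := ⟨2, 3, by decide, by decide⟩

section Twist

variable {F : Type*} [Field F] [Algebra (ZMod 5) F] {c : Fˣ}

theorem twist_of_sq_eq_one {A : GL (Fin 2) (ZMod 5)} (h : A.det ^ 2 = 1) :
    twist c A = GeneralLinearGroup.map (algebraMap (ZMod 5) F) A := if_pos h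

theorem twist_of_sq_eq_neg_one {A : GL (Fin 2) (ZMod 5)} (h : A.det ^ 2 = -1) :
    twist c A = GeneralLinearGroup.scalar (Fin 2) c *
      GeneralLinearGroup.map (algebraMap (ZMod 5) F) A :=
  if_neg (by rw [h]; exact neg_one_ne_one_units_zmod_five)

theorem twist_mul_map (A B : GL (Fin 2) (ZMod 5)) :
    twist c A * GeneralLinearGroup.map (algebraMap (ZMod 5) F) B =
      GeneralLinearGroup.map (algebraMap (ZMod 5) F) (A * B * A⁻¹) * twist c A := by
  by_cases h : A.det ^ 2 = 1
  · simp [twist_of_sq_eq_one h]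
  · have := units_zmod_five_sq_eq_neg_one h
    rw [twist_of_sq_eq_neg_one this, ← mul_assoc, ← GeneralLinearGroup.scalar_commute, mul_assoc,
      mul_assoc]
    simp

theorem map_scalar_unitTwo (hc : (c : F) ^ 2 = 2) :
    GeneralLinearGroup.map (algebraMap (ZMod 5) F) (GeneralLinearGroup.scalar (Fin 2) unitTwo) =
      GeneralLinearGroup.scalar (Fin 2) c ^ 2 := by
  rw [GeneralLinearGroup.map_scalar, ← map_pow]
  congr 1
  ext
  simpa [unitTwo, hc] using map_ofNat (algebraMap (ZMod 5) F) 2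

theorem det_scalar_unitTwo_mul (A : GL (Fin 2) (ZMod 5)) :
    (GeneralLinearGroup.scalar (Fin 2) unitTwo * A).det ^ 2 = A.det ^ 2 := by
  rw [map_mul, GeneralLinearGroup.det_scalar, mul_pow]
  rw [show (unitTwo ^ Fintype.card (Fin 2)) ^ 2 = 1 by decide, one_mul]

theorem twist_mul_twist_mem_range (hc : (c : F) ^ 2 = 2) (A B : GL (Fin 2) (ZMod 5)) :
    twist c A * twist c B ∈ Set.range (twist c : _ → GL (Fin 2) F) := by
  by_cases hA : A.det ^ 2 = 1 <;> by_cases hB : B.det ^ 2 = 1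
  · exact ⟨A * B, by
      rw [twist_of_sq_eq_one hA, twist_of_sq_eq_one hB,
        twist_of_sq_eq_one (by rw [map_mul, mul_pow, hA, hB, one_mul]), map_mul]⟩
  · have hB' := units_zmod_five_sq_eq_neg_one hB
    exact ⟨A * B, by
      rw [twist_of_sq_eq_one hA, twist_of_sq_eq_neg_one hB',
        twist_of_sq_eq_neg_one (by rw [map_mul, mul_pow, hA, hB', one_mul]), map_mul,
        ← mul_assoc, ← mul_assoc, GeneralLinearGroup.scalar_commute]⟩
  · have hA' := units_zmod_five_sq_eq_neg_one hA
    exact ⟨A * B, by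
      rw [twist_of_sq_eq_neg_one hA', twist_of_sq_eq_one hB,
        twist_of_sq_eq_neg_one (by rw [map_mul, mul_pow, hA', hB, mul_one]), map_mul,
        ← mul_assoc]⟩
  · have hA' := units_zmod_five_sq_eq_neg_one hA
    have hB' := units_zmod_five_sq_eq_neg_one hB
    refine ⟨GeneralLinearGroup.scalar (Fin 2) unitTwo * (A * B), ?_⟩
    rw [twist_of_sq_eq_neg_one hA', twist_of_sq_eq_neg_one hB', twist_of_sq_eq_one (by
      rw [det_scalar_unitTwo_mul, map_mul, mul_pow, hA', hB']; decide),
      map_mul, map_scalar_unitTwo hc, map_mul, pow_two, mul_assoc, mul_assoc,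
      ← mul_assoc (GeneralLinearGroup.map _ A), ← GeneralLinearGroup.scalar_commute, mul_assoc]

theorem twist_inv_mem_range (hc : (c : F) ^ 2 = 2) (A : GL (Fin 2) (ZMod 5)) :
    (twist c A)⁻¹ ∈ Set.range (twist c : _ → GL (Fin 2) F) := by
  by_cases hA : A.det ^ 2 = 1
  · exact ⟨A⁻¹, by
      rw [twist_of_sq_eq_one hA, twist_of_sq_eq_one (by rw [map_inv, inv_pow, hA, inv_one]),
        map_inv]⟩
  · have hA' := units_zmod_five_sq_eq_neg_one hA
    refine ⟨(GeneralLinearGroup.scalar (Fin 2) unitTwo * A)⁻¹, ?_⟩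
    rw [twist_of_sq_eq_neg_one hA', twist_of_sq_eq_neg_one (by
      rw [map_inv, inv_pow, det_scalar_unitTwo_mul, hA']; decide), map_inv, map_mul,
      map_scalar_unitTwo hc, pow_two, mul_assoc, _root_.mul_inv_rev (GeneralLinearGroup.scalar _ c),
      GeneralLinearGroup.scalar_commute, inv_mul_cancel_right]

theorem map_algebraMap_injective :
    Function.Injective (GeneralLinearGroup.map (n := Fin 2) (algebraMap (ZMod 5) F)) := by
  intro A B h
  have : Fact (Nat.Prime 5) := ⟨by norm_num⟩
  ext i j
  apply (algebraMap (ZMod 5) F).injective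
  simpa using congrArg (fun M : GL (Fin 2) F => M i j) h

theorem map_ne_scalar_mul_map (hc : orderOf c = 8) (A B : GL (Fin 2) (ZMod 5)) :
    GeneralLinearGroup.map (algebraMap (ZMod 5) F) A ≠ GeneralLinearGroup.scalar (Fin 2) c *
      GeneralLinearGroup.map (algebraMap (ZMod 5) F) B := by
  intro h
  have h' : GeneralLinearGroup.map (algebraMap (ZMod 5) F) (A * B⁻¹) =
      GeneralLinearGroup.scalar (Fin 2) c := by
    rw [map_mul, h, map_inv, mul_inv_cancel_right]
  have h0 := congrArg (fun M : GL (Fin 2) F => M 0 0) h'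
  simp only [GeneralLinearGroup.map_apply, GeneralLinearGroup.coe_scalar, Matrix.scalar_apply,
    Matrix.diagonal_apply_eq] at h0
  generalize (A * B⁻¹) 0 0 = x at h0
  have hx : x ≠ 0 := by rintro rfl; simp at h0; exact c.ne_zero h0.symm
  have hx4 : x ^ 4 = 1 := by clear h0; revert x; decide
  have hc4 : c ^ 4 = 1 := by
    ext
    rw [Units.val_pow_eq_pow_val, ← h0, ← map_pow, hx4, map_one, Units.val_one]
  have := orderOf_dvd_of_pow_eq_one hc4
  rw [hc] at this
  omega

theorem twist_injective (hc : orderOf c = 8) :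
    Function.Injective (twist c : _ → GL (Fin 2) F) := by
  intro A B h
  by_cases hA : A.det ^ 2 = 1 <;> by_cases hB : B.det ^ 2 = 1
  · rw [twist_of_sq_eq_one hA, twist_of_sq_eq_one hB] at h
    exact map_algebraMap_injective h
  · rw [twist_of_sq_eq_one hA, twist_of_sq_eq_neg_one (units_zmod_five_sq_eq_neg_one hB)] at h
    exact (map_ne_scalar_mul_map hc _ _ h).elim
  · rw [twist_of_sq_eq_neg_one (units_zmod_five_sq_eq_neg_one hA), twist_of_sq_eq_one hB] at h
    exact (map_ne_scalar_mul_map hc _ _ h.symm).elim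
  · rw [twist_of_sq_eq_neg_one (units_zmod_five_sq_eq_neg_one hA),
      twist_of_sq_eq_neg_one (units_zmod_five_sq_eq_neg_one hB)] at h
    exact map_algebraMap_injective (mul_left_cancel h)

theorem card_GL_two_zmod_five : Nat.card (GL (Fin 2) (ZMod 5)) = 480 := by
  have : Fact (Nat.Prime 5) := ⟨by norm_num⟩
  rw [Matrix.card_GL_field, Fin.prod_univ_two, ZMod.card]
  norm_num

/-- The subgroup of `GL₂(F)` formed by the twisted images of the matrices over `𝔽₅`. -/
noncomputable def twistSubgroup (hc : (c : F) ^ 2 = 2) : Subgroup (GL (Fin 2) F) where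
  carrier := Set.range (twist c)
  mul_mem' := by
    rintro _ _ ⟨A, rfl⟩ ⟨B, rfl⟩
    exact twist_mul_twist_mem_range hc A B
  one_mem' := ⟨1, by rw [twist_of_sq_eq_one (by simp), map_one]⟩
  inv_mem' := by
    rintro _ ⟨A, rfl⟩
    exact twist_inv_mem_range hc A

theorem card_twistSubgroup (hc : (c : F) ^ 2 = 2) (hc8 : orderOf c = 8) :
    Nat.card (twistSubgroup hc) = 480 := by
  rw [← card_GL_two_zmod_five]
  exact Nat.card_range_of_injective (twist_injective hc8)

/-- The upper triangular matrix with rows `(a, b)` and `(0, d)`. -/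
def upperTriangular (a d : (ZMod 5)ˣ) (b : ZMod 5) : GL (Fin 2) (ZMod 5) :=
  ⟨!![a, b; 0, d], !![↑a⁻¹, -(↑a⁻¹ * b * ↑d⁻¹); 0, ↑d⁻¹],
    by ext i j; fin_cases i <;> fin_cases j <;> simp [Matrix.mul_apply, ← mul_assoc],
    by ext i j; fin_cases i <;> fin_cases j <;> simp [Matrix.mul_apply, mul_assoc]⟩

theorem upperTriangular_one_pow (k : ℕ) :
    (upperTriangular 1 1 1 ^ k : Matrix (Fin 2) (Fin 2) (ZMod 5)) = !![1, (k : ZMod 5); 0, 1] := by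
  induction k with
  | zero => simp [Matrix.one_fin_two]
  | succ k ih =>
    rw [pow_succ, ih]
    simp [upperTriangular, add_comm]

theorem upperTriangular_one_pow_five : upperTriangular 1 1 1 ^ 5 = 1 := by
  apply Units.ext
  rw [Units.val_pow_eq_pow_val, upperTriangular_one_pow, Units.val_one]
  decide

theorem exists_upperTriangular_mul_eq_pow_mul (a d : (ZMod 5)ˣ) (b : ZMod 5) :
    ∃ k : ℕ, upperTriangular a d b * upperTriangular 1 1 1 =
      upperTriangular 1 1 1 ^ k * upperTriangular a d b := by
  refine ⟨((a * d⁻¹ : (ZMod 5)ˣ) : ZMod 5).val, Units.ext ?_⟩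
  rw [Units.val_mul, Units.val_mul, Units.val_pow_eq_pow_val, upperTriangular_one_pow,
    ZMod.natCast_zmod_val]
  simp [upperTriangular, add_comm]

theorem upperTriangular_injective :
    Function.Injective fun x : (ZMod 5)ˣ × (ZMod 5)ˣ × ZMod 5 =>
      upperTriangular x.1 x.2.1 x.2.2 := by
  rintro ⟨a, d, b⟩ ⟨a', d', b'⟩ h
  have h' (i j : Fin 2) := congrArg (fun M : GL (Fin 2) (ZMod 5) => M i j) h
  have h₁ := h' 0 0
  have h₂ := h' 1 1
  have h₃ := h' 0 1
  simp only [upperTriangular] at h₁ h₂ h₃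
  simp at h₁ h₂ h₃
  simp [Units.ext_iff, h₁, h₂, h₃]

/-- The antidiagonal matrix with rows `(0, 1)` and `(2, 0)`. -/
def antidiagonalTwo : GL (Fin 2) (ZMod 5) :=
  ⟨!![0, 1; 2, 0], !![0, 3; 1, 0], by decide, by decide⟩

theorem antidiagonalTwo_mul_ne (k : ℕ) :
    antidiagonalTwo * upperTriangular 1 1 1 ≠ upperTriangular 1 1 1 ^ k * antidiagonalTwo := by
  intro h
  have h₁ := congrArg (fun M : GL (Fin 2) (ZMod 5) => M 1 1) h
  simp only [Units.val_mul, Units.val_pow_eq_pow_val, upperTriangular_one_pow] at h₁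
  revert h₁
  simp [upperTriangular, antidiagonalTwo]
  decide

theorem det_antidiagonalTwo_sq : antidiagonalTwo.det ^ 2 = -1 := by
  ext
  simp [antidiagonalTwo, Matrix.det_fin_two]
  decide

theorem card_sylow_five_twistSubgroup (hc : (c : F) ^ 2 = 2) (hc8 : orderOf c = 8) :
    Nat.card (Sylow 5 (twistSubgroup hc)) = 6 := by
  have : Fact (Nat.Prime 5) := ⟨by norm_num⟩
  have hcard := card_twistSubgroup hc hc8
  have hfin : Finite (twistSubgroup hc) := Nat.finite_of_card_ne_zero (by omega)
  set T := upperTriangular 1 1 1 with hT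
  have hTdet : T.det ^ 2 = 1 := by
    ext; simp [hT, upperTriangular, Matrix.det_fin_two]
  let e : GL (Fin 2) (ZMod 5) → twistSubgroup hc := fun A => ⟨twist c A, A, rfl⟩
  have he : Function.Injective e := fun A B h => twist_injective hc8 (congrArg Subtype.val h)
  have heT (A : GL (Fin 2) (ZMod 5)) (k : ℕ) :
      e A * e T * (e A)⁻¹ = e T ^ k ↔ A * T = T ^ k * A := by
    rw [← mul_inv_eq_iff_eq_mul, ← (map_algebraMap_injective (F := F)).eq_iff, Subtype.ext_iff]
    change twist c A * twist c T * (twist c A)⁻¹ = twist c T ^ k ↔ _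
    rw [twist_of_sq_eq_one hTdet, twist_mul_map, mul_inv_cancel_right, map_pow]
  have heT5 : e T ^ 5 = 1 := by
    apply Subtype.ext
    change twist c T ^ 5 = 1
    rw [twist_of_sq_eq_one hTdet, ← map_pow, upperTriangular_one_pow_five, map_one]
  have heT1 : e T ≠ 1 := by
    intro h
    refine antidiagonalTwo_mul_ne 0 ((heT _ _).mp ?_)
    rw [h, mul_one, mul_inv_cancel, pow_zero]
  refine card_sylow_five_eq_six hcard (Subgroup.zpowers (e T)) ?_ ?_ ?_
  · rw [Nat.card_zpowers, orderOf_eq_prime heT5 heT1]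
  · intro hnormal
    have h := hnormal.conj_mem (e T) (Subgroup.mem_zpowers _) (e antidiagonalTwo)
    obtain ⟨k, hk⟩ := mem_powers_iff_mem_zpowers.mpr h
    exact antidiagonalTwo_mul_ne k ((heT _ _).mp hk.symm)
  · have hmem (x : (ZMod 5)ˣ × (ZMod 5)ˣ × ZMod 5) : e (upperTriangular x.1 x.2.1 x.2.2) ∈
        Subgroup.normalizer (Subgroup.zpowers (e T) : Set (twistSubgroup hc)) := by
      obtain ⟨k, hk⟩ := exists_upperTriangular_mul_eq_pow_mul x.1 x.2.1 x.2.2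
      apply Subgroup.mem_normalizer_fintype
      rintro _ ⟨n, rfl⟩
      dsimp only
      rw [← conj_zpow, (heT _ _).mpr hk]
      exact Subgroup.zpow_mem _ (Subgroup.pow_mem _ (Subgroup.mem_zpowers _) _) _
    have hle := Nat.card_le_card_of_injective (fun x => (⟨_, hmem x⟩ : Subgroup.normalizer _))
      fun x y h => upperTriangular_injective (he (congrArg Subtype.val h))
    have h80 : Nat.card ((ZMod 5)ˣ × (ZMod 5)ˣ × ZMod 5) = 80 := by
      simp [show Nat.totient 5 = 4 by decide]
    rwa [h80] at hle

theorem closure_eq_twistSubgroup (hc : (c : F) ^ 2 = 2) :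
    Subgroup.closure (Set.range (SpecialLinearGroup.toGL.comp
      (SpecialLinearGroup.map (n := Fin 2) (algebraMap (ZMod 5) F))) ∪
        {GeneralLinearGroup.scalar (Fin 2) c ^ 2, twist c antidiagonalTwo}) =
      twistSubgroup hc := by
  set K : Subgroup (GL (Fin 2) F) := Subgroup.closure _
  have hSL (A : SpecialLinearGroup (Fin 2) (ZMod 5)) :
      (SpecialLinearGroup.toGL.comp (SpecialLinearGroup.map (algebraMap (ZMod 5) F))) A =
        GeneralLinearGroup.map (algebraMap (ZMod 5) F) A.toGL := Units.ext rfl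
  have hs : GeneralLinearGroup.scalar (Fin 2) c ^ 2 ∈ K :=
    Subgroup.subset_closure (Or.inr (Or.inl rfl))
  have hj : twist c antidiagonalTwo ∈ K := Subgroup.subset_closure (Or.inr (Or.inr rfl))
  have hone (A : GL (Fin 2) (ZMod 5)) (hA : A.det = 1) :
      GeneralLinearGroup.map (algebraMap (ZMod 5) F) A ∈ K :=
    Subgroup.subset_closure <| Or.inl
      ⟨⟨A, congrArg Units.val hA⟩, (hSL _).trans (congrArg _ (Units.ext rfl))⟩
  have hsq (A : GL (Fin 2) (ZMod 5)) (hA : A.det ^ 2 = 1) :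
      GeneralLinearGroup.map (algebraMap (ZMod 5) F) A ∈ K := by
    have hdet : A.det = 1 ∨ A.det = -1 := by
      generalize A.det = d at hA
      revert d; decide
    rcases hdet with h | h
    · exact hone A h
    · have := hone (GeneralLinearGroup.scalar (Fin 2) unitTwo * A) (by
        rw [map_mul, GeneralLinearGroup.det_scalar, h]; decide)
      rw [map_mul, map_scalar_unitTwo hc] at this
      exact (K.mul_mem_cancel_left hs).mp this
  apply le_antisymm
  · rw [Subgroup.closure_le]
    rintro _ (⟨A, rfl⟩ | rfl | rfl)
    · rw [hSL]
      exact ⟨A.toGL, twist_of_sq_eq_one (by simp)⟩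
    · refine ⟨GeneralLinearGroup.scalar (Fin 2) unitTwo, ?_⟩
      rw [twist_of_sq_eq_one (by rw [GeneralLinearGroup.det_scalar]; decide), map_scalar_unitTwo hc]
    · exact ⟨_, rfl⟩
  · rintro _ ⟨A, rfl⟩
    by_cases hA : A.det ^ 2 = 1
    · rw [twist_of_sq_eq_one hA]
      exact hsq A hA
    · have hA' := units_zmod_five_sq_eq_neg_one hA
      have h := K.mul_mem hj (hsq (antidiagonalTwo⁻¹ * A) (by
        rw [map_mul, map_inv, mul_pow, inv_pow, det_antidiagonalTwo_sq, hA']; decide))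
      rwa [twist_of_sq_eq_neg_one det_antidiagonalTwo_sq, mul_assoc, ← map_mul,
        mul_inv_cancel_left, ← twist_of_sq_eq_neg_one hA'] at h

end Twist

/-- The group `G̃ = 4₋PGL₂(𝔽₅) = C₄·₆S₅ ⊆ GL₂(F̄₅)` (generated by the image of
`SL₂(𝔽₅)`, the scalar matrix `2·I` and `[[0, ζ], [-ζ⁻¹, 0]]`) contains a subgroup of
order `80`, and any two subgroups of order `80` are conjugate in `G̃`. -/
theorem subgroups_of_order_80_conjugate
    (F : Type) [Field F] [Algebra (ZMod 5) F] [IsAlgClosed F] [Algebra.IsAlgebraic (ZMod 5) F]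
    (ζ : F) (hζ8 : orderOf ζ = 8) (hζ2 : ζ ^ 2 = 2)
    (s j : Matrix.GeneralLinearGroup (Fin 2) F)
    (hs : (s : Matrix (Fin 2) (Fin 2) F) = (2 : Matrix (Fin 2) (Fin 2) F))
    (hj : (j : Matrix (Fin 2) (Fin 2) F) = !![0, ζ; -ζ⁻¹, 0])
    (G : Subgroup (Matrix.GeneralLinearGroup (Fin 2) F))
    (hG : G = Subgroup.closure
      (Set.range (Matrix.SpecialLinearGroup.toGL.comp
        (Matrix.SpecialLinearGroup.map (algebraMap (ZMod 5) F))) ∪ {s, j})) :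
    (∃ H : Subgroup G, Nat.card H = 80) ∧
      ∀ H₁ H₂ : Subgroup G, Nat.card H₁ = 80 → Nat.card H₂ = 80 →
        ∃ g : G, Subgroup.map (MulAut.conj g).toMonoidHom H₁ = H₂ := by
  obtain ⟨c, rfl⟩ : ∃ c : Fˣ, (c : F) = ζ :=
    ⟨Units.mk0 ζ (by rintro rfl; simp at hζ8), rfl⟩
  have hc8 : orderOf c = 8 := by rwa [← orderOf_units]
  have hs' : s = GeneralLinearGroup.scalar (Fin 2) c ^ 2 := by
    ext i j
    rw [hs, ← map_pow, GeneralLinearGroup.coe_scalar, Units.val_pow_eq_pow_val, hζ2,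
      map_ofNat]
  have hj' : j = twist c antidiagonalTwo := by
    rw [twist_of_sq_eq_neg_one det_antidiagonalTwo_sq]
    have h5 : (5 : F) = 0 := by
      have := map_ofNat (algebraMap (ZMod 5) F) 5
      rw [← this, show (OfNat.ofNat 5 : ZMod 5) = 0 by decide, map_zero]
    have hinv : -(c : F)⁻¹ = c * 2 := by
      field_simp
      linear_combination -2 * hζ2 - h5
    have h2 : algebraMap (ZMod 5) F 2 = 2 := map_ofNat _ 2
    ext i j
    rw [hj, hinv, Units.val_mul, GeneralLinearGroup.coe_scalar, Matrix.scalar_apply,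
      Matrix.diagonal_mul, GeneralLinearGroup.map_apply]
    fin_cases i <;> fin_cases j <;> simp [antidiagonalTwo, h2]
  rw [hs', hj', closure_eq_twistSubgroup hζ2] at hG
  subst hG
  exact exists_card_eq_eighty_and_conj (card_twistSubgroup hζ2 hc8)
    (card_sylow_five_twistSubgroup hζ2 hc8)
end

section
/- Let F̄₅ be an algebraic closure of 𝔽₅ = ℤ/5ℤ, fix ζ ∈ F̄₅ of multiplicative order 8 with ζ² = 2, and let G̃ ⊆ GL₂(F̄₅) be the subgroup generated by the image of SL₂(𝔽₅), the scalar matrix 2·I, and the matrix [[0, ζ], [−ζ⁻¹, 0]]. Then G̃ has exactly three subgroups of index 2. -/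
open Matrix

namespace Subgroup

variable {G : Type*} [Group G]

/-- Two index-two subgroups agreeing on a generating set are equal. -/
theorem eq_of_index_two_of_closure_eq_top {S : Set G} (hS : closure S = ⊤) {H K : Subgroup G}
    (hH : H.index = 2) (hK : K.index = 2) (h : ∀ x ∈ S, (x ∈ H ↔ x ∈ K)) : H = K := by
  ext x
  have hx : x ∈ closure S := hS ▸ mem_top x
  induction hx using closure_induction with
  | mem x hx => exact h x hx
  | one => simp [one_mem]
  | mul x y _ _ hx hy =>
    rw [mul_mem_iff_of_index_two hH, mul_mem_iff_of_index_two hK]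
    exact iff_congr hx hy
  | inv x _ hx => simpa only [inv_mem_iff] using hx

/-- The complement of the symmetric difference of two index-two subgroups. -/
def agreement (H K : Subgroup G) (hH : H.index = 2) (hK : K.index = 2) : Subgroup G where
  carrier := {x | x ∈ H ↔ x ∈ K}
  one_mem' := by simp [one_mem]
  mul_mem' {x y} hx hy := by
    simp only [Set.mem_ofPred_eq] at hx hy ⊢
    rw [mul_mem_iff_of_index_two hH, mul_mem_iff_of_index_two hK, hx, hy]
  inv_mem' {x} hx := by simpa only [Set.mem_ofPred_eq, inv_mem_iff] using hx

theorem mem_agreement {H K : Subgroup G} {hH : H.index = 2} {hK : K.index = 2} {x : G} :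
    x ∈ agreement H K hH hK ↔ (x ∈ H ↔ x ∈ K) := Iff.rfl

theorem index_agreement {H K : Subgroup G} (hH : H.index = 2) (hK : K.index = 2) {a : G}
    (haH : a ∉ H) (haK : a ∈ K) : (agreement H K hH hK).index = 2 := by
  rw [index_eq_two_iff]
  refine ⟨a, fun b => ?_⟩
  simp only [mem_agreement, mul_mem_iff_of_index_two hH, mul_mem_iff_of_index_two hK, haH, haK]
  tauto

/-- A subgroup of index two contains the image of any group generated by squares. -/
theorem apply_mem_of_index_two {P : Type*} [Group P] (hP : closure {x : P | IsSquare x} = ⊤)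
    (f : P →* G) {H : Subgroup G} (hH : H.index = 2) (x : P) : f x ∈ H := by
  have h : closure {x : P | IsSquare x} ≤ H.comap f := by
    rw [closure_le]
    rintro _ ⟨y, rfl⟩
    simpa using mul_self_mem_of_index_two hH (f y)
  exact h (hP ▸ mem_top x)

/-- If `G` is generated by `s`, `t` and elements lying in every subgroup of index two, and `s`, `t`
are separated by subgroups of index two, then `G` has exactly three subgroups of index two. -/
theorem card_index_two_eq_three {S : Set G} {s t : G} (hS : closure (S ∪ {s, t}) = ⊤)
    (hmem : ∀ H : Subgroup G, H.index = 2 → ∀ x ∈ S, x ∈ H) {K L : Subgroup G}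
    (hK : K.index = 2) (hL : L.index = 2) (hsK : s ∉ K) (htK : t ∈ K) (hsL : s ∈ L)
    (htL : t ∉ L) : Nat.card {H : Subgroup G // H.index = 2} = 3 := by
  have hM := index_agreement hK hL hsK hsL
  have hsM : s ∉ agreement K L hK hL := by simp [mem_agreement, hsK, hsL]
  have htM : t ∉ agreement K L hK hL := by simp [mem_agreement, htK, htL]
  have key {H H' : Subgroup G} (hH : H.index = 2) (hH' : H'.index = 2)
      (h1 : s ∈ H ↔ s ∈ H') (h2 : t ∈ H ↔ t ∈ H') : H = H' := by
    refine eq_of_index_two_of_closure_eq_top hS hH hH' ?_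
    rintro x (hx | rfl | rfl)
    · exact iff_of_true (hmem H hH x hx) (hmem H' hH' x hx)
    · exact h1
    · exact h2
  have hset : {H : Subgroup G | H.index = 2} = {K, L, agreement K L hK hL} := by
    ext H
    simp only [Set.mem_ofPred_eq, Set.mem_insert_iff, Set.mem_singleton_iff]
    refine ⟨fun hH => ?_, by rintro (rfl | rfl | rfl) <;> assumption⟩
    by_cases hs : s ∈ H <;> by_cases ht : t ∈ H
    · have : H = ⊤ := by
        rw [eq_top_iff, ← hS, closure_le]
        rintro x (hx | rfl | rfl)
        exacts [hmem H hH x hx, hs, ht]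
      simp [this] at hH
    · exact .inr (.inl (key hH hL (iff_of_true hs hsL) (iff_of_false ht htL)))
    · exact .inl (key hH hK (iff_of_false hs hsK) (iff_of_true ht htK))
    · exact .inr (.inr (key hH hM (iff_of_false hs hsM) (iff_of_false ht htM)))
  change Nat.card ({H : Subgroup G | H.index = 2} : Set (Subgroup G)) = 3
  rw [hset, Nat.card_coe_set_eq, Set.ncard_eq_three]
  refine ⟨K, L, _, ?_, ?_, ?_, rfl⟩
  · rintro rfl; exact hsK hsL
  · intro h; exact htM (h ▸ htK)
  · intro h; exact hsM (h ▸ hsL)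

end Subgroup

namespace Matrix.SpecialLinearGroup

variable {K : Type*} [Field K]

/-- The special linear group of degree two over a field in which `2` is invertible is generated by
squares, since it is generated by transvections. -/
theorem closure_isSquare_eq_top (h2 : (2 : K) ≠ 0) :
    Subgroup.closure {x : SpecialLinearGroup (Fin 2) K | IsSquare x} = ⊤ := by
  have add_halves (a : K) : a / 2 + a / 2 = a := by
    rw [← add_div, ← two_mul, mul_div_cancel_left₀ _ h2]
  let u : K → SpecialLinearGroup (Fin 2) K := fun a => ⟨!![1, a; 0, 1], by simp⟩
  let l : K → SpecialLinearGroup (Fin 2) K := fun a => ⟨!![1, 0; a, 1], by simp⟩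
  have hu (a : K) : u a ∈ Subgroup.closure {x : SpecialLinearGroup (Fin 2) K | IsSquare x} := by
    refine Subgroup.subset_closure ⟨u (a / 2), Subtype.ext ?_⟩
    rw [coe_mul]
    simp [u, add_halves]
  have hl (a : K) : l a ∈ Subgroup.closure {x : SpecialLinearGroup (Fin 2) K | IsSquare x} := by
    refine Subgroup.subset_closure ⟨l (a / 2), Subtype.ext ?_⟩
    rw [coe_mul]
    simp [l, add_halves]
  have key (x : SpecialLinearGroup (Fin 2) K) (hx : x.1 1 0 ≠ 0) :
      x ∈ Subgroup.closure {x : SpecialLinearGroup (Fin 2) K | IsSquare x} := by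
    have hdet : x.1 0 0 * x.1 1 1 - x.1 0 1 * x.1 1 0 = 1 := by
      rw [← det_fin_two]; exact x.2
    have : x = u ((x.1 0 0 - 1) / x.1 1 0) * l (x.1 1 0) * u ((x.1 1 1 - 1) / x.1 1 0) := by
      refine Subtype.ext ?_
      rw [coe_mul, coe_mul]
      ext i k
      fin_cases i <;> fin_cases k <;> simp [u, l, hx, mul_apply]
      · field_simp
        linear_combination -hdet
      · field_simp
        ring
    rw [this]
    exact mul_mem (mul_mem (hu _) (hl _)) (hu _)
  rw [eq_top_iff]
  intro x _
  by_cases hx : x.1 1 0 = 0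
  · have hdet : x.1 0 0 * x.1 1 1 - x.1 0 1 * x.1 1 0 = 1 := by
      rw [← det_fin_two]; exact x.2
    have h00 : x.1 0 0 ≠ 0 := by rintro h; simp [h, hx] at hdet
    rw [← Subgroup.mul_mem_cancel_left _ (hl 1)]
    exact key _ (by rw [coe_mul]; simpa [l, hx, mul_apply] using h00)
  · exact key x hx

end Matrix.SpecialLinearGroup

/-- The group `G̃ = 4₋PGL₂(𝔽₅) = C₄·₆S₅ ⊆ GL₂(F̄₅)` (generated by the image of
`SL₂(𝔽₅)`, the scalar matrix `2·I` and `[[0, ζ], [-ζ⁻¹, 0]]`) has exactly three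
subgroups of index `2`. -/
theorem three_subgroups_of_index_two
    (F : Type) [Field F] [Algebra (ZMod 5) F] [IsAlgClosed F] [Algebra.IsAlgebraic (ZMod 5) F]
    (ζ : F) (hζ8 : orderOf ζ = 8) (hζ2 : ζ ^ 2 = 2)
    (s j : Matrix.GeneralLinearGroup (Fin 2) F)
    (hs : (s : Matrix (Fin 2) (Fin 2) F) = (2 : Matrix (Fin 2) (Fin 2) F))
    (hj : (j : Matrix (Fin 2) (Fin 2) F) = !![0, ζ; -ζ⁻¹, 0])
    (G : Subgroup (Matrix.GeneralLinearGroup (Fin 2) F))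
    (hG : G = Subgroup.closure
      (Set.range (Matrix.SpecialLinearGroup.toGL.comp
        (Matrix.SpecialLinearGroup.map (algebraMap (ZMod 5) F))) ∪ {s, j})) :
    Nat.card {H : Subgroup G // H.index = 2} = 3 := by
  have h2' : (2 : ZMod 5) ≠ 0 := by decide
  have : Fact (Nat.Prime 5) := ⟨by norm_num⟩
  have hinj := (algebraMap (ZMod 5) F).injective
  have : CharP F 5 := charP_of_injective_algebraMap hinj 5
  have h5 : (5 : F) = 0 := CharP.cast_eq_zero F 5
  have h2 : (2 : F) ≠ 0 := by
    intro h
    exact one_ne_zero (α := F) (by linear_combination h5 - 2 * h)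
  have h11 : (1 : F) ≠ -1 := fun h => h2 (by linear_combination h)
  have hζ0 : ζ ≠ 0 := by rintro rfl; simp at hζ2; exact h2 hζ2.symm
  let ρ := (SpecialLinearGroup.toGL (n := Fin 2)).comp
    (SpecialLinearGroup.map (algebraMap (ZMod 5) F))
  have hζ4 : ζ ^ 4 = -1 := by linear_combination (ζ ^ 2 + 2) * hζ2 + h5
  let Φ : GL (Fin 2) F →* GL (Fin 2) F := GeneralLinearGroup.map (frobenius F 5)
  have hdets : s.det = -1 := by
    ext
    simp only [GeneralLinearGroup.val_det_apply, hs, det_fin_two, ofNat_apply]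
    simp
    linear_combination h5
  have hdetj : j.det = 1 := by
    ext
    simp [hj, det_fin_two, hζ0]
  have hdetρ (x) : (ρ x).det = 1 := by
    ext
    simp [ρ]
  have hΦs : Φ s = s := by
    ext i k
    have h32 : (2 : F) ^ 5 = 2 := by linear_combination 6 * h5
    fin_cases i <;> fin_cases k <;> simp [Φ, hs, frobenius_def, ofNat_apply, h32]
  have hΦj : Φ j = -j := by
    ext i k
    fin_cases i <;> fin_cases k <;> simp [Φ, hj, frobenius_def, pow_succ _ 4, hζ4,
      Even.neg_pow (⟨2, rfl⟩ : Even 4)]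
  have hΦρ (x) : Φ (ρ x) = ρ x := by
    ext i k
    simp [Φ, ρ, frobenius_def, ← map_pow, ZMod.pow_card]
  have hneg (x : GL (Fin 2) F) : -x ≠ x := by
    intro h
    have hx : x.1 = 0 := by
      ext i k
      have hik : -x.1 i k = x.1 i k := congrArg (fun y : GL (Fin 2) F => y.1 i k) h
      refine (mul_eq_zero.1 (?_ : 2 * x.1 i k = 0)).resolve_left h2
      linear_combination -hik
    exact x.ne_zero hx
  change G = Subgroup.closure (Set.range ρ ∪ {s, j}) at hG
  clear_value ρ Φ
  have hdet {x} (hx : x ∈ G) : x.det = 1 ∨ x.det = -1 := by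
    rw [hG] at hx
    induction hx using Subgroup.closure_induction with
    | mem x hx =>
      rcases hx with ⟨y, rfl⟩ | rfl | rfl
      exacts [.inl (hdetρ y), .inr hdets, .inl hdetj]
    | one => simp
    | mul x y _ _ hx hy => rcases hx with hx | hx <;> rcases hy with hy | hy <;> simp [hx, hy]
    | inv x _ hx => rcases hx with hx | hx <;> simp [hx]
  have hΦ {x} (hx : x ∈ G) : Φ x = x ∨ Φ x = -x := by
    rw [hG] at hx
    induction hx using Subgroup.closure_induction with
    | mem x hx =>
      rcases hx with ⟨y, rfl⟩ | rfl | rfl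
      exacts [.inl (hΦρ y), .inl hΦs, .inr hΦj]
    | one => simp
    | mul x y _ _ hx hy => rcases hx with hx | hx <;> rcases hy with hy | hy <;> simp [hx, hy]
    | inv x _ hx => rcases hx with hx | hx <;> simp [hx]
  have hρG (x) : ρ x ∈ G := hG ▸ Subgroup.subset_closure (.inl ⟨x, rfl⟩)
  have hsG : s ∈ G := hG ▸ Subgroup.subset_closure (by simp)
  have hjG : j ∈ G := hG ▸ Subgroup.subset_closure (by simp)
  let K : Subgroup G := (GeneralLinearGroup.det (n := Fin 2) (R := F)).ker.subgroupOf G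
  let L : Subgroup G := (Φ.eqLocus (MonoidHom.id _)).subgroupOf G
  have hu : (1 : Fˣ) ≠ -1 := fun h => h11 (by simpa using congrArg Units.val h)
  have memK (x : G) : x ∈ K ↔ x.1.det = 1 := Iff.rfl
  have memL (x : G) : x ∈ L ↔ Φ x.1 = x.1 := Iff.rfl
  have hK : K.index = 2 := by
    rw [Subgroup.index_eq_two_iff]
    refine ⟨⟨s, hsG⟩, fun b => ?_⟩
    rcases hdet b.2 with hb | hb <;> simp [memK, hb, hdets, hu.symm]
  have hL : L.index = 2 := by
    rw [Subgroup.index_eq_two_iff]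
    refine ⟨⟨j, hjG⟩, fun b => ?_⟩
    rcases hΦ b.2 with hb | hb <;> simp [memL, hb, hΦj, hneg]
  refine Subgroup.card_index_two_eq_three (S := Set.range (ρ.codRestrict G hρG))
    (s := ⟨s, hsG⟩) (t := ⟨j, hjG⟩) ?_ ?_ hK hL ?_ ?_ ?_ ?_
  · subst hG
    rw [← Subgroup.closure_closure_coe_preimage]
    congr 1
    ext x
    simp [Subtype.ext_iff]
  · rintro H hH _ ⟨x, rfl⟩
    exact Subgroup.apply_mem_of_index_two
      (SpecialLinearGroup.closure_isSquare_eq_top h2') _ hH x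
  · simp [memK, hdets, hu.symm]
  · simp [memK, hdetj]
  · simp [memL, hΦs]
  · simp [memL, hΦj, hneg]
end
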